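/- arXiv:2602.01650 — 5 statements merged into one kernel-verified Lean document; each statement's English description precedes it below -/
import Mathlib

section
/- The zero component L(m,n)_0 is the free product (coproduct) of its subalgebras L(m,n)_0^{xy} and L(m,n)_0^{yx} over K: for every unital K-algebra C and every pair of K-algebra homomorphisms f : L(m,n)_0^{xy} → C and g : L(m,n)_0^{yx} → C there exists a unique K-algebra homomorphism h : L(m,n)_0 → C whose restrictions to L(m,n)_0^{xy} and L(m,n)_0^{yx} are f and g respectively. -/
open scoped BigOperators

/-- Generators of the Leavitt algebra `L(m,n)`: `Sum.inl (i,j)` is the x-letter `x_{ij}`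
(`1 ≤ i ≤ m`, `1 ≤ j ≤ n`, written 0-indexed), and `Sum.inr (j,i)` is the y-letter `y_{ji}`. -/
abbrev LGen (m n : ℕ) := (Fin m × Fin n) ⊕ (Fin n × Fin m)

/-- The defining relations of the Leavitt algebra `L(m,n)`:
`∑_j x_{ij} y_{ji'} = δ_{i,i'}` and `∑_i y_{ji} x_{ij'} = δ_{j,j'}`. -/
inductive LRel (K : Type) [Field K] (m n : ℕ) :
    FreeAlgebra K (LGen m n) → FreeAlgebra K (LGen m n) → Prop
  | xy (i i' : Fin m) :
      LRel K m n
        (∑ j : Fin n, FreeAlgebra.ι K (Sum.inl (i, j)) * FreeAlgebra.ι K (Sum.inr (j, i')))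
        (if i = i' then 1 else 0)
  | yx (j j' : Fin n) :
      LRel K m n
        (∑ i : Fin m, FreeAlgebra.ι K (Sum.inr (j, i)) * FreeAlgebra.ι K (Sum.inl (i, j')))
        (if j = j' then 1 else 0)

/-- The Leavitt algebra `L(m,n)`, presented by the generators `x_{ij}, y_{ji}` and the
relations `∑_j x_{ij} y_{ji'} = δ_{i,i'}`, `∑_i y_{ji} x_{ij'} = δ_{j,j'}`. -/
abbrev Leavitt (K : Type) [Field K] (m n : ℕ) := RingQuot (LRel K m n)

/-- The image of a generator in `L(m,n)`. -/
noncomputable def lgen (K : Type) [Field K] {m n : ℕ} (z : LGen m n) : Leavitt K m n :=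
  RingQuot.mkAlgHom K (LRel K m n) (FreeAlgebra.ι K z)

/-- The generator `x_{ij}` of `L(m,n)` (0-indexed). -/
noncomputable def xg (K : Type) [Field K] {m n : ℕ} (i : Fin m) (j : Fin n) : Leavitt K m n :=
  lgen K (Sum.inl (i, j))

/-- The generator `y_{ji}` of `L(m,n)` (0-indexed). -/
noncomputable def yg (K : Type) [Field K] {m n : ℕ} (j : Fin n) (i : Fin m) : Leavitt K m n :=
  lgen K (Sum.inr (j, i))

/-- A word over the generating set `X` of `L(m,n)`. -/
abbrev LWord (m n : ℕ) := List (LGen m n)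

/-- The image of a word in `L(m,n)` (product of the images of its letters). -/
noncomputable def wordToL (K : Type) [Field K] {m n : ℕ} (w : LWord m n) : Leavitt K m n :=
  (w.map (lgen K)).prod

/-- A word is balanced if it has equally many x-letters and y-letters. -/
def LWord.Balanced {m n : ℕ} (w : LWord m n) : Prop :=
  w.countP Sum.isLeft = w.countP Sum.isRight

/-- The degree of a word: number of x-letters minus number of y-letters. -/
def LWord.degree {m n : ℕ} (w : LWord m n) : ℤ :=
  (w.countP Sum.isLeft : ℤ) - (w.countP Sum.isRight : ℤ)

/-- The `k`-component of the canonical grading of `L(m,n)`: the `K`-linear span of the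
images of all words of degree `k`. -/
noncomputable def Lcomponent (K : Type) [Field K] (m n : ℕ) (k : ℤ) :
    Submodule K (Leavitt K m n) :=
  Submodule.span K {a | ∃ w : LWord m n, w.degree = k ∧ wordToL K w = a}

/-- A pair of consecutive letters is forbidden if it is of the form `x_{in} y_{ni'}` or
`y_{jm} x_{mj'}` (the second index of the first letter being maximal). -/
def LForbidden {m n : ℕ} (z z' : LGen m n) : Prop :=
  (∃ (i i' : Fin m) (j : Fin n), (j : ℕ) = n - 1 ∧ z = Sum.inl (i, j) ∧ z' = Sum.inr (j, i')) ∨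
  (∃ (j j' : Fin n) (i : Fin m), (i : ℕ) = m - 1 ∧ z = Sum.inr (j, i) ∧ z' = Sum.inl (i, j'))

/-- A word is irreducible if it contains no forbidden subword `x_{in} y_{ni'}` or
`y_{jm} x_{mj'}`. -/
def LWord.Irr {m n : ℕ} (w : LWord m n) : Prop :=
  ∀ (u v : LWord m n) (z z' : LGen m n), w = u ++ z :: z' :: v → ¬ LForbidden z z'

/-- A nonempty balanced word is prime if it is not the concatenation of two nonempty
balanced words. -/
def LWord.IsPrime {m n : ℕ} (w : LWord m n) : Prop :=
  w ≠ [] ∧ w.Balanced ∧ ∀ u v : LWord m n, w = u ++ v → u ≠ [] → v ≠ [] → ¬ u.Balanced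

/-- An xy word: a nonempty balanced word whose first letter is an x-letter and whose
last letter is a y-letter. -/
def LWord.XY {m n : ℕ} (w : LWord m n) : Prop :=
  w.Balanced ∧ (∃ p, w.head? = some (Sum.inl p)) ∧ (∃ q, w.getLast? = some (Sum.inr q))

/-- A yx word: a nonempty balanced word whose first letter is a y-letter and whose
last letter is an x-letter. -/
def LWord.YX {m n : ℕ} (w : LWord m n) : Prop :=
  w.Balanced ∧ (∃ q, w.head? = some (Sum.inr q)) ∧ (∃ p, w.getLast? = some (Sum.inl p))

/-- Membership in the submonoid `⟨X⟩₀^{xy}` of `⟨X⟩₀` generated by the prime xy words. -/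
def LWord.InXY {m n : ℕ} (w : LWord m n) : Prop :=
  ∃ ws : List (LWord m n), (∀ u ∈ ws, u.IsPrime ∧ u.XY) ∧ ws.flatten = w

/-- Membership in the submonoid `⟨X⟩₀^{yx}` of `⟨X⟩₀` generated by the prime yx words. -/
def LWord.InYX {m n : ℕ} (w : LWord m n) : Prop :=
  ∃ ws : List (LWord m n), (∀ u ∈ ws, u.IsPrime ∧ u.YX) ∧ ws.flatten = w

/-- The subalgebra `L(m,n)₀^{xy}` of `L(m,n)` generated by images of all prime xy words. -/
noncomputable def L0xy (K : Type) [Field K] (m n : ℕ) : Subalgebra K (Leavitt K m n) :=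
  Algebra.adjoin K {a | ∃ w : LWord m n, w.IsPrime ∧ w.XY ∧ wordToL K w = a}

/-- The subalgebra `L(m,n)₀^{yx}` of `L(m,n)` generated by images of all prime yx words. -/
noncomputable def L0yx (K : Type) [Field K] (m n : ℕ) : Subalgebra K (Leavitt K m n) :=
  Algebra.adjoin K {a | ∃ w : LWord m n, w.IsPrime ∧ w.YX ∧ wordToL K w = a}

/-- The zero component `L(m,n)₀`, as a subalgebra: it is generated (indeed spanned)
by the images of all balanced words. -/
noncomputable def L0 (K : Type) [Field K] (m n : ℕ) : Subalgebra K (Leavitt K m n) :=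
  Algebra.adjoin K {a | ∃ w : LWord m n, w.Balanced ∧ wordToL K w = a}

section WordCombinatorics

variable {m n : ℕ}

/-- The weight of a letter relative to a side `s`: letters of type `s` (`true` for x-letters,
`false` for y-letters) count `1`, the others `-1`. -/
def letterWeight (s : Bool) (z : LGen m n) : ℤ := if z.isLeft = s then 1 else -1

/-- The total weight of a word relative to a side. -/
def wordWeight (s : Bool) (w : LWord m n) : ℤ := (w.map (letterWeight s)).sum

/-- Started at height `h`, all partial weights of the word stay nonnegative. -/
def StaysAbove (s : Bool) : ℤ → LWord m n → Prop
  | h, [] => 0 ≤ h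
  | h, z :: w => 0 ≤ h ∧ StaysAbove s (h + letterWeight s z) w

@[simp] lemma wordWeight_nil (s : Bool) : wordWeight s ([] : LWord m n) = 0 := rfl

@[simp] lemma wordWeight_cons (s : Bool) (z : LGen m n) (w : LWord m n) :
    wordWeight s (z :: w) = letterWeight s z + wordWeight s w := by
  simp [wordWeight]

@[simp] lemma wordWeight_append (s : Bool) (u v : LWord m n) :
    wordWeight s (u ++ v) = wordWeight s u + wordWeight s v := by
  simp [wordWeight]

lemma letterWeight_eq (s : Bool) (z : LGen m n) :
    letterWeight s z = 1 ∧ z.isLeft = s ∨ letterWeight s z = -1 ∧ z.isLeft = !s := by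
  unfold letterWeight
  cases s <;> cases z <;> simp

lemma letterWeight_add_of_isLeft_ne {s b : Bool} {z z' : LGen m n} (hz : z.isLeft = b)
    (hz' : z'.isLeft = !b) : letterWeight s z + letterWeight s z' = 0 := by
  subst hz
  unfold letterWeight
  rw [hz']
  cases s <;> cases z <;> simp

lemma wordWeight_eq_zero_iff (s : Bool) (w : LWord m n) : wordWeight s w = 0 ↔ w.Balanced := by
  have key : wordWeight s w = (if s then 1 else -1) *
      ((w.countP Sum.isLeft : ℤ) - (w.countP Sum.isRight : ℤ)) := by
    induction w with
    | nil => simp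
    | cons z w ih =>
      rw [wordWeight_cons, ih]
      cases s <;> cases z <;> simp [letterWeight, List.countP_cons] <;> ring
  unfold LWord.Balanced
  rw [key]
  cases s <;> simp <;> omega

lemma StaysAbove.nonneg {s : Bool} {h : ℤ} {w : LWord m n} (hw : StaysAbove s h w) : 0 ≤ h := by
  cases w with
  | nil => exact hw
  | cons z w => exact hw.1

lemma staysAbove_append {s : Bool} {h : ℤ} {u v : LWord m n} :
    StaysAbove s h (u ++ v) ↔ StaysAbove s h u ∧ StaysAbove s (h + wordWeight s u) v := by
  induction u generalizing h with
  | nil => simpa [StaysAbove] using StaysAbove.nonneg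
  | cons z u ih => simp [StaysAbove, ih, and_assoc, add_assoc]

lemma StaysAbove.weight_nonneg {s : Bool} {h : ℤ} {w : LWord m n} (hw : StaysAbove s h w) :
    0 ≤ h + wordWeight s w :=
  (staysAbove_append (v := []).1 (by simpa using hw)).2

lemma staysAbove_singleton {s : Bool} {h : ℤ} {z : LGen m n} :
    StaysAbove s h [z] ↔ 0 ≤ h ∧ 0 ≤ h + letterWeight s z := Iff.rfl

/-- A word has a balanced prefix whose complement stays on one side, and continues to do so
when extended by any letter of type `b`. -/
lemma exists_balanced_prefix (b : Bool) (u : LWord m n) :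
    ∃ (s : Bool) (u₀ u₁ : LWord m n), u = u₀ ++ u₁ ∧ u₀.Balanced ∧ StaysAbove s 0 u₁ ∧
      ∀ z : LGen m n, z.isLeft = b → StaysAbove s 0 (u₁ ++ [z]) := by
  induction u using List.reverseRecOn generalizing b with
  | nil =>
    refine ⟨b, [], [], rfl, rfl, le_rfl, fun z hz => ?_⟩
    simp [StaysAbove, letterWeight, hz]
  | append_singleton u a ih =>
    obtain ⟨s, u₀, u₁, rfl, h₀, -, h₁⟩ := ih a.isLeft
    have ha := h₁ a rfl
    have hn := ha.weight_nonneg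
    by_cases hz : wordWeight s (u₁ ++ [a]) = 0
    · refine ⟨b, u₀ ++ (u₁ ++ [a]), [], by simp, ?_, le_rfl, fun z hz => ?_⟩
      · rw [← wordWeight_eq_zero_iff s] at h₀ ⊢
        rw [wordWeight_append, h₀, hz, add_zero]
      · simp [StaysAbove, letterWeight, hz]
    · refine ⟨s, u₀, u₁ ++ [a], by simp, h₀, ha, fun z _ => ?_⟩
      rw [staysAbove_append, staysAbove_singleton]
      refine ⟨ha, hn, ?_⟩
      rcases letterWeight_eq s z with h | h <;> omega

/-- A word staying above zero, followed by a word returning to weight zero, already returns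
to zero along a prefix while staying above zero. -/
lemma exists_return_prefix {s : Bool} {h : ℤ} (hh : 0 ≤ h) (v : LWord m n)
    (hv : h + wordWeight s v = 0) :
    ∃ v₁ v₂ : LWord m n, v = v₁ ++ v₂ ∧ StaysAbove s h v₁ ∧ h + wordWeight s v₁ = 0 := by
  induction v generalizing h with
  | nil => exact ⟨[], [], rfl, hh, hv⟩
  | cons z v ih =>
    by_cases h0 : h = 0
    · exact ⟨[], z :: v, rfl, hh, by simpa using h0⟩
    · have h1 : 0 ≤ h + letterWeight s z := by
        rcases letterWeight_eq s z with h | h <;> omega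
      obtain ⟨v₁, v₂, rfl, h₁, h₂⟩ := ih h1 (by simpa [add_assoc] using hv)
      exact ⟨z :: v₁, v₂, rfl, ⟨hh, h₁⟩, by simpa [add_assoc] using h₂⟩

/-- Inserting two letters of opposite types into a balanced word affects only a factor lying
on one side. -/
lemma exists_one_sided_factor (b : Bool) {u v : LWord m n} (huv : (u ++ v).Balanced) :
    ∃ (s : Bool) (u₀ u₁ v₁ v₂ : LWord m n), u = u₀ ++ u₁ ∧ v = v₁ ++ v₂ ∧
      u₀.Balanced ∧ (u₁ ++ v₁).Balanced ∧ StaysAbove s 0 (u₁ ++ v₁) ∧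
      ∀ z z' : LGen m n, z.isLeft = b → z'.isLeft = (!b) →
        StaysAbove s 0 (u₁ ++ z :: z' :: v₁) ∧ (u₁ ++ z :: z' :: v₁).Balanced := by
  obtain ⟨s, u₀, u₁, rfl, h₀, hu₁, h₁⟩ := exists_balanced_prefix b u
  have hn := hu₁.weight_nonneg
  rw [← wordWeight_eq_zero_iff s] at huv h₀
  obtain ⟨v₁, v₂, rfl, h₂, h₃⟩ := exists_return_prefix (s := s) hn v (by
    simp only [wordWeight_append] at huv
    omega)
  refine ⟨s, u₀, u₁, v₁, v₂, rfl, rfl, (wordWeight_eq_zero_iff s _).1 h₀, ?_,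
    staysAbove_append.2 ⟨hu₁, h₂⟩, fun z z' hl hl' => ?_⟩
  · rw [← wordWeight_eq_zero_iff s]
    simpa using h₃
  · have hadd := letterWeight_add_of_isLeft_ne (s := s) hl hl'
    constructor
    · refine staysAbove_append.2 ⟨hu₁, hn, (staysAbove_append.1 (h₁ z hl)).2.2, ?_⟩
      rwa [add_assoc, hadd, add_zero]
    · rw [← wordWeight_eq_zero_iff s]
      simp only [wordWeight_append, wordWeight_cons]
      omega

/-- A prime word stays on the side given by its first letter. -/
lemma LWord.IsPrime.staysAbove {z : LGen m n} {w : LWord m n}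
    (hw : LWord.IsPrime (z :: w)) : StaysAbove z.isLeft 0 (z :: w) := by
  have key : ∀ p q : LWord m n, z :: w = p ++ q → p ≠ [] →
      StaysAbove z.isLeft 0 p ∧ (q ≠ [] → 0 < wordWeight z.isLeft p) := by
    intro p
    induction p using List.reverseRecOn with
    | nil => simp
    | append_singleton p a ih =>
      intro q hq _
      rcases eq_or_ne p [] with rfl | hp
      · obtain ⟨rfl, -⟩ : z = a ∧ w = q := by simpa using hq
        simp [StaysAbove, letterWeight]
      · obtain ⟨h₁, h₂⟩ := ih (a :: q) (by simpa using hq) hp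
        have hpos := h₂ (by simp)
        have hnn : 0 ≤ wordWeight z.isLeft p + letterWeight z.isLeft a := by
          rcases letterWeight_eq z.isLeft a with h | h <;> omega
        refine ⟨staysAbove_append.2 ⟨h₁, staysAbove_singleton.2 ⟨by omega, by omega⟩⟩, fun hq0 => ?_⟩
        have hne := hw.2.2 (p ++ [a]) q hq (by simp) hq0
        rw [← wordWeight_eq_zero_iff z.isLeft] at hne
        simp only [wordWeight_append, wordWeight_cons, wordWeight_nil] at hne ⊢
        omega
  exact (key (z :: w) [] (by simp) (by simp)).1

end WordCombinatorics

section Subalgebras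

variable (K : Type) [Field K] {m n : ℕ}

lemma wordToL_append (u v : LWord m n) :
    wordToL K (u ++ v) = wordToL K u * wordToL K v := by
  simp [wordToL]

/-- The two subalgebras `L(m,n)₀^{xy}` and `L(m,n)₀^{yx}`, indexed by the type of the first
letter of their generating words. -/
noncomputable def sideAlg (m n : ℕ) : Bool → Subalgebra K (Leavitt K m n)
  | true => L0xy K m n
  | false => L0yx K m n

variable {K}

/-- A balanced word staying on one side lies in the corresponding subalgebra. -/
lemma wordToL_mem_sideAlg {s : Bool} {w : LWord m n} (hw : StaysAbove s 0 w)
    (hb : w.Balanced) : wordToL K w ∈ sideAlg K m n s := by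
  induction hl : w.length using Nat.strong_induction_on generalizing w with
  | _ l ih =>
    subst hl
    rcases eq_or_ne w [] with rfl | hne
    · exact one_mem _
    by_cases hp : w.IsPrime
    · have hhead : ∃ z, w.head? = some z ∧ z.isLeft = s := by
        obtain ⟨z, w, rfl⟩ := List.exists_cons_of_ne_nil hne
        refine ⟨z, rfl, ?_⟩
        have := hw.2.nonneg
        rcases letterWeight_eq s z with h | h
        · exact h.2
        · omega
      have hlast : ∃ z, w.getLast? = some z ∧ z.isLeft = !s := by
        obtain ⟨w, z, rfl⟩ := (List.eq_nil_or_concat w).resolve_left hne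
        rw [List.concat_eq_append] at *
        refine ⟨z, by simp, ?_⟩
        have := (staysAbove_append.1 hw).1.weight_nonneg
        rw [← wordWeight_eq_zero_iff s] at hb
        simp only [wordWeight_append, wordWeight_cons, wordWeight_nil] at hb
        rcases letterWeight_eq s z with h | h
        · omega
        · exact h.2
      obtain ⟨a, ha, has⟩ := hhead
      obtain ⟨c, hc, hcs⟩ := hlast
      cases s
      · refine Algebra.subset_adjoin ⟨w, hp, ⟨hb, ?_, ?_⟩, rfl⟩
        · cases a <;> simp_all
        · cases c <;> simp_all
      · refine Algebra.subset_adjoin ⟨w, hp, ⟨hb, ?_, ?_⟩, rfl⟩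
        · cases a <;> simp_all
        · cases c <;> simp_all
    · obtain ⟨u, v, rfl, hu, hv, hub⟩ : ∃ u v, w = u ++ v ∧ u ≠ [] ∧ v ≠ [] ∧
          LWord.Balanced u := by
        by_contra! hcon
        exact hp ⟨hne, hb, hcon⟩
      have hw' := staysAbove_append.1 hw
      have hub' := (wordWeight_eq_zero_iff s _).2 hub
      have hvb : LWord.Balanced v := by
        rw [← wordWeight_eq_zero_iff s] at hb ⊢
        simpa [hub'] using hb
      rw [hub', add_zero] at hw'
      rw [wordToL_append]
      refine mul_mem (ih _ ?_ hw'.1 hub rfl) (ih _ ?_ hw'.2 hvb rfl)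
      · simpa using List.length_pos_of_ne_nil hv
      · simpa using List.length_pos_of_ne_nil hu

lemma sideAlg_le_L0 (s : Bool) : sideAlg K m n s ≤ L0 K m n := by
  cases s <;>
  · refine Algebra.adjoin_mono ?_
    rintro _ ⟨w, hw, -, rfl⟩
    exact ⟨w, hw.2.1, rfl⟩

/-- The two subalgebras generate the zero component. -/
lemma wordToL_mem_of_balanced {T : Subalgebra K (Leavitt K m n)}
    (hT : ∀ s, sideAlg K m n s ≤ T) {w : LWord m n} (hw : w.Balanced) : wordToL K w ∈ T := by
  induction hl : w.length using Nat.strong_induction_on generalizing w with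
  | _ l ih =>
    subst hl
    rcases List.eq_nil_or_concat w with rfl | ⟨u, z, rfl⟩
    · exact one_mem _
    rw [List.concat_eq_append] at *
    obtain ⟨s, u₀, u₁, rfl, h₀, -, h₁⟩ := exists_balanced_prefix z.isLeft u
    have hb : LWord.Balanced (u₁ ++ [z]) := by
      rw [← wordWeight_eq_zero_iff s] at h₀ hw ⊢
      rwa [List.append_assoc, wordWeight_append, h₀, zero_add] at hw
    rw [List.append_assoc, wordToL_append]
    refine mul_mem (ih _ ?_ h₀ rfl) (hT s (wordToL_mem_sideAlg (h₁ z rfl) hb))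
    simp only [List.length_append, List.length_singleton]
    omega

lemma mem_span_of_mem_L0 {a : Leavitt K m n} (ha : a ∈ L0 K m n) :
    a ∈ Submodule.span K {a | ∃ w : LWord m n, w.Balanced ∧ wordToL K w = a} := by
  rw [L0, ← Subalgebra.mem_toSubmodule, Algebra.adjoin_eq_span] at ha
  refine Submodule.span_mono (fun b hb => ?_) ha
  induction hb using Submonoid.closure_induction with
  | mem b hb => exact hb
  | one => exact ⟨[], rfl, rfl⟩
  | mul b c _ _ hb hc =>
    obtain ⟨u, hu, rfl⟩ := hb
    obtain ⟨v, hv, rfl⟩ := hc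
    refine ⟨u ++ v, ?_, wordToL_append K u v⟩
    rw [← wordWeight_eq_zero_iff true] at hu hv ⊢
    rw [wordWeight_append, hu, hv, add_zero]

end Subalgebras

section Extension

variable {K : Type} [Field K] {m n : ℕ} {C : Type} [Ring C] [Algebra K C]

/-- Cut a word at the ends of its nonempty balanced prefixes and multiply the values of `F` on
the pieces; `acc` is the part of the current piece already read. -/
def prodPieces (F : LWord m n → C) : LWord m n → LWord m n → C
  | _, [] => 1
  | acc, z :: w =>
    if wordWeight true (acc ++ [z]) = 0 then F (acc ++ [z]) * prodPieces F [] w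
    else prodPieces F (acc ++ [z]) w

lemma prodPieces_append (F : LWord m n → C) (acc v r : LWord m n)
    (hacc : acc = [] ∨ wordWeight true acc ≠ 0) (h : wordWeight true (acc ++ v) = 0) :
    prodPieces F acc (v ++ r) = prodPieces F acc v * prodPieces F [] r := by
  induction v generalizing acc with
  | nil =>
    obtain rfl : acc = [] := hacc.resolve_right (by simpa using h)
    simp [prodPieces]
  | cons z v ih =>
    have h' : wordWeight true (acc ++ [z]) + wordWeight true v = 0 := by
      simpa [add_assoc] using h
    rw [List.cons_append, prodPieces, prodPieces]
    split_ifs with hz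
    · rw [ih [] (Or.inl rfl) (by simpa [hz] using h'), mul_assoc]
    · exact ih _ (Or.inr hz) (by rw [wordWeight_append, h'])

open Classical in
/-- Extension by zero of a homomorphism on one of the two subalgebras. -/
noncomputable def sideExt (φ : ∀ s, sideAlg K m n s →ₐ[K] C) (s : Bool) (a : Leavitt K m n) : C :=
  if h : a ∈ sideAlg K m n s then φ s ⟨a, h⟩ else 0

/-- The value of a one-sided word. -/
noncomputable def pieceValue (φ : ∀ s, sideAlg K m n s →ₐ[K] C) : LWord m n → C
  | [] => 1
  | z :: w => sideExt φ z.isLeft (wordToL K (z :: w))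

lemma sideExt_mul (φ : ∀ s, sideAlg K m n s →ₐ[K] C) {s : Bool} {a b : Leavitt K m n}
    (ha : a ∈ sideAlg K m n s) (hb : b ∈ sideAlg K m n s) :
    sideExt φ s (a * b) = sideExt φ s a * sideExt φ s b := by
  simp only [sideExt, ha, hb, mul_mem ha hb, dif_pos, ← map_mul]
  rfl

lemma pieceValue_eq (φ : ∀ s, sideAlg K m n s →ₐ[K] C) {s : Bool} {w : LWord m n}
    (hw : StaysAbove s 0 w) : pieceValue φ w = sideExt φ s (wordToL K w) := by
  cases w with
  | nil =>
    have h : wordToL K ([] : LWord m n) ∈ sideAlg K m n s := one_mem _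
    rw [pieceValue, sideExt, dif_pos h]
    exact (map_one (φ s)).symm
  | cons z w =>
    have h0 := hw.2.nonneg
    obtain rfl : z.isLeft = s := by
      rcases letterWeight_eq s z with h | h
      · exact h.2
      · omega
    rfl

lemma prodPieces_eq_sideExt (φ : ∀ s, sideAlg K m n s →ₐ[K] C) {s : Bool} (acc v : LWord m n)
    (hacc : acc = [] ∨ wordWeight true acc ≠ 0) (hb : LWord.Balanced (acc ++ v))
    (hv : StaysAbove s 0 (acc ++ v)) :
    prodPieces (pieceValue φ) acc v = sideExt φ s (wordToL K (acc ++ v)) := by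
  induction v generalizing acc with
  | nil =>
    obtain rfl : acc = [] :=
      hacc.resolve_right (by simpa using (wordWeight_eq_zero_iff true _).2 hb)
    rw [← pieceValue_eq φ hv]
    rfl
  | cons z v ih =>
    rw [List.append_cons] at hb hv ⊢
    rw [prodPieces]
    split_ifs with hz
    · have hz' := (wordWeight_eq_zero_iff true _).1 hz
      have hv' := staysAbove_append.1 hv
      rw [(wordWeight_eq_zero_iff s _).2 hz', add_zero] at hv'
      have hvb : LWord.Balanced v := by
        rw [← wordWeight_eq_zero_iff true] at hb ⊢
        rwa [wordWeight_append, hz, zero_add] at hb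
      rw [ih [] (Or.inl rfl) hvb hv'.2, pieceValue_eq φ hv'.1, wordToL_append _ (acc ++ [z]),
        sideExt_mul φ (wordToL_mem_sideAlg hv'.1 hz') (wordToL_mem_sideAlg hv'.2 hvb)]
      rfl
    · exact ih _ (Or.inr hz) hb hv

/-- The common extension on words, zero on unbalanced words. -/
noncomputable def wordValue (φ : ∀ s, sideAlg K m n s →ₐ[K] C) (w : LWord m n) : C :=
  if wordWeight true w = 0 then prodPieces (pieceValue φ) [] w else 0

lemma wordValue_append (φ : ∀ s, sideAlg K m n s →ₐ[K] C) {u : LWord m n} (v : LWord m n)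
    (hu : u.Balanced) : wordValue φ (u ++ v) = wordValue φ u * wordValue φ v := by
  rw [← wordWeight_eq_zero_iff true] at hu
  simp only [wordValue, wordWeight_append, hu, zero_add, if_true]
  split_ifs
  · exact prodPieces_append _ _ _ _ (Or.inl rfl) hu
  · rw [mul_zero]

lemma wordValue_eq_sideExt (φ : ∀ s, sideAlg K m n s →ₐ[K] C) {s : Bool} {w : LWord m n}
    (hb : w.Balanced) (hw : StaysAbove s 0 w) :
    wordValue φ w = sideExt φ s (wordToL K w) := by
  rw [wordValue, if_pos ((wordWeight_eq_zero_iff true _).2 hb)]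
  exact prodPieces_eq_sideExt φ [] w (Or.inl rfl) hb hw

/-- The extension on words respects quadratic relations between letters of opposite types. -/
lemma sum_wordValue (φ : ∀ s, sideAlg K m n s →ₐ[K] C) {ι : Type} [Fintype ι] (b : Bool)
    (z z' : ι → LGen m n) (hz : ∀ i, (z i).isLeft = b) (hz' : ∀ i, (z' i).isLeft = !b) (δ : K)
    (hδ : ∑ i, lgen K (z i) * lgen K (z' i) = δ • 1) (u v : LWord m n) :
    ∑ i, wordValue φ (u ++ z i :: z' i :: v) = δ • wordValue φ (u ++ v) := by
  by_cases huv : LWord.Balanced (u ++ v)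
  · obtain ⟨s, u₀, u₁, v₁, v₂, rfl, rfl, h₀, h₁, h₂, h₃⟩ := exists_one_sided_factor b huv
    have hsplit : wordValue φ ((u₀ ++ u₁) ++ (v₁ ++ v₂)) =
        wordValue φ u₀ * (sideExt φ s (wordToL K (u₁ ++ v₁)) * wordValue φ v₂) := by
      rw [← wordValue_eq_sideExt φ h₁ h₂, ← wordValue_append φ _ h₁, ← wordValue_append φ _ h₀]
      simp
    have hsplit' (i : ι) : wordValue φ ((u₀ ++ u₁) ++ z i :: z' i :: (v₁ ++ v₂)) =
        wordValue φ u₀ *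
          (sideExt φ s (wordToL K (u₁ ++ z i :: z' i :: v₁)) * wordValue φ v₂) := by
      obtain ⟨h₄, h₅⟩ := h₃ _ _ (hz i) (hz' i)
      rw [← wordValue_eq_sideExt φ h₅ h₄, ← wordValue_append φ _ h₅, ← wordValue_append φ _ h₀]
      simp
    simp only [hsplit, hsplit']
    rw [← Finset.mul_sum, ← Finset.sum_mul, ← mul_smul_comm, ← smul_mul_assoc]
    congr 2
    have hmem := wordToL_mem_sideAlg (K := K) h₂ h₁
    have hmem' (i : ι) : wordToL K (u₁ ++ z i :: z' i :: v₁) ∈ sideAlg K m n s :=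
      wordToL_mem_sideAlg (h₃ _ _ (hz i) (hz' i)).1 (h₃ _ _ (hz i) (hz' i)).2
    simp only [sideExt, hmem, hmem', dif_pos]
    rw [← map_sum, ← map_smul]
    congr 1
    apply Subtype.ext
    have hword (i : ι) : wordToL K (u₁ ++ z i :: z' i :: v₁) =
        wordToL K u₁ * (lgen K (z i) * lgen K (z' i)) * wordToL K v₁ := by
      simp [wordToL, mul_assoc]
    simp only [AddSubmonoidClass.coe_finsetSum, SetLike.val_smul, hword]
    rw [← Finset.sum_mul, ← Finset.mul_sum, hδ, wordToL_append]
    simp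
  · have hw (i : ι) : wordWeight true (u ++ z i :: z' i :: v) = wordWeight true (u ++ v) := by
      have := letterWeight_add_of_isLeft_ne (s := true) (hz i) (hz' i)
      simp only [wordWeight_append, wordWeight_cons]
      omega
    rw [← wordWeight_eq_zero_iff true] at huv
    simp only [wordValue, hw, if_neg huv, Finset.sum_const_zero, smul_zero]

/-- The linear extension of `wordValue` to the free algebra. -/
noncomputable def freeValue (φ : ∀ s, sideAlg K m n s →ₐ[K] C) :
    FreeAlgebra K (LGen m n) →ₗ[K] C :=
  (FreeAlgebra.basisFreeMonoid K (LGen m n)).constr K fun w => wordValue φ w.toList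

lemma basisFreeMonoid_ofList (w : LWord m n) :
    FreeAlgebra.basisFreeMonoid K (LGen m n) (FreeMonoid.ofList w) =
      (w.map (FreeAlgebra.ι K)).prod := by
  simp [FreeAlgebra.basisFreeMonoid, FreeAlgebra.equivMonoidAlgebraFreeMonoid,
    MonoidAlgebra.lift_single, FreeMonoid.lift_apply]

lemma freeValue_prod (φ : ∀ s, sideAlg K m n s →ₐ[K] C) (w : LWord m n) :
    freeValue φ (w.map (FreeAlgebra.ι K)).prod = wordValue φ w := by
  rw [← basisFreeMonoid_ofList, freeValue, Module.Basis.constr_basis]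
  rfl

/-- Two linear maps on the free algebra agreeing on words are equal. -/
lemma linearMap_ext_words {f g : FreeAlgebra K (LGen m n) →ₗ[K] C}
    (h : ∀ w : LWord m n, f (w.map (FreeAlgebra.ι K)).prod = g (w.map (FreeAlgebra.ι K)).prod) :
    f = g :=
  (FreeAlgebra.basisFreeMonoid K (LGen m n)).ext fun w => by
    simpa only [← basisFreeMonoid_ofList, FreeMonoid.ofList_toList] using h w.toList

lemma freeValue_sum (φ : ∀ s, sideAlg K m n s →ₐ[K] C) {ι : Type} [Fintype ι] (b : Bool)
    (z z' : ι → LGen m n) (hz : ∀ i, (z i).isLeft = b) (hz' : ∀ i, (z' i).isLeft = !b) (δ : K)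
    (hδ : ∑ i, lgen K (z i) * lgen K (z' i) = δ • 1) (c d : FreeAlgebra K (LGen m n)) :
    freeValue φ (c * (∑ i, FreeAlgebra.ι K (z i) * FreeAlgebra.ι K (z' i)) * d) =
      freeValue φ (c * (δ • 1) * d) := by
  set S := ∑ i, FreeAlgebra.ι K (z i) * FreeAlgebra.ι K (z' i) with hS
  have hwords (u v : LWord m n) :
      freeValue φ ((u.map (FreeAlgebra.ι K)).prod * S * (v.map (FreeAlgebra.ι K)).prod) =
        freeValue φ ((u.map (FreeAlgebra.ι K)).prod * (δ • 1) *
          (v.map (FreeAlgebra.ι K)).prod) := by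
    have h := sum_wordValue φ b z z' hz hz' δ hδ u v
    simp only [← freeValue_prod, ← map_sum, ← map_smul] at h
    convert h using 2
    · simp [hS, Finset.mul_sum, Finset.sum_mul, mul_assoc]
    · simp
  have hright (u : LWord m n) :
      freeValue φ ∘ₗ LinearMap.mulLeft K ((u.map (FreeAlgebra.ι K)).prod * S) =
        freeValue φ ∘ₗ LinearMap.mulLeft K ((u.map (FreeAlgebra.ι K)).prod * (δ • 1)) :=
    linearMap_ext_words (hwords u)
  have hleft : freeValue φ ∘ₗ LinearMap.mulRight K d ∘ₗ LinearMap.mulRight K S =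
      freeValue φ ∘ₗ LinearMap.mulRight K d ∘ₗ LinearMap.mulRight K (δ • 1) :=
    linearMap_ext_words fun u => LinearMap.congr_fun (hright u) d
  exact LinearMap.congr_fun hleft c

lemma freeValue_rel (φ : ∀ s, sideAlg K m n s →ₐ[K] C) {a b : FreeAlgebra K (LGen m n)}
    (hab : LRel K m n a b) (c d : FreeAlgebra K (LGen m n)) :
    freeValue φ (c * a * d) = freeValue φ (c * b * d) := by
  have hmk := RingQuot.mkAlgHom_rel K hab
  cases hab with
  | xy i i' =>
    have hite : (if i = i' then 1 else 0 : FreeAlgebra K (LGen m n)) =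
        (if i = i' then 1 else 0 : K) • 1 := by split_ifs <;> simp
    rw [hite] at hmk ⊢
    exact freeValue_sum φ true (fun j => Sum.inl (i, j)) (fun j => Sum.inr (j, i'))
      (fun _ => rfl) (fun _ => rfl) _ (by simpa [lgen] using hmk) c d
  | yx j j' =>
    have hite : (if j = j' then 1 else 0 : FreeAlgebra K (LGen m n)) =
        (if j = j' then 1 else 0 : K) • 1 := by split_ifs <;> simp
    rw [hite] at hmk ⊢
    exact freeValue_sum φ false (fun i => Sum.inr (j, i)) (fun i => Sum.inl (i, j'))
      (fun _ => rfl) (fun _ => rfl) _ (by simpa [lgen] using hmk) c d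

lemma freeValue_eq_of_mk_eq (φ : ∀ s, sideAlg K m n s →ₐ[K] C) {a b : FreeAlgebra K (LGen m n)}
    (hab : RingQuot.mkAlgHom K (LRel K m n) a = RingQuot.mkAlgHom K (LRel K m n) b) :
    freeValue φ a = freeValue φ b := by
  have hrel : Relation.EqvGen (RingQuot.Rel (LRel K m n)) a b := by
    have hab' : RingQuot.mkRingHom (LRel K m n) a = RingQuot.mkRingHom (LRel K m n) b := by
      rwa [← RingQuot.mkAlgHom_coe K]
    simp only [RingQuot.mkRingHom_def] at hab'
    exact Quot.eqvGen_exact (congrArg RingQuot.toQuot hab')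
  suffices h : ∀ c d, freeValue φ (c * a * d) = freeValue φ (c * b * d) by simpa using h 1 1
  clear hab
  induction hrel with
  | rel a b h =>
    induction h with
    | of h => exact freeValue_rel φ h
    | add_left _ ih => intro c d; simp [mul_add, add_mul, ih]
    | @mul_left a b e _ ih => intro c d; simpa [mul_assoc] using ih c (e * d)
    | @mul_right e a b _ ih => intro c d; simpa [mul_assoc] using ih (c * e) d
  | refl => exact fun _ _ => rfl
  | symm _ _ _ ih => exact fun c d => (ih c d).symm
  | trans _ _ _ _ _ ih ih' => exact fun c d => (ih c d).trans (ih' c d)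

/-- The common extension as a linear map on the Leavitt algebra. -/
lemma exists_linearMap_wordToL (φ : ∀ s, sideAlg K m n s →ₐ[K] C) :
    ∃ Λ : Leavitt K m n →ₗ[K] C, ∀ w : LWord m n, Λ (wordToL K w) = wordValue φ w := by
  let π := (RingQuot.mkAlgHom K (LRel K m n)).toLinearMap
  have hπ : Function.Surjective π := RingQuot.mkAlgHom_surjective K _
  refine ⟨(LinearMap.ker π).liftQ (freeValue φ) (fun a ha => ?_) ∘ₗ
    (π.quotKerEquivOfSurjective hπ).symm.toLinearMap, fun w => ?_⟩
  · rw [LinearMap.mem_ker, ← map_zero (freeValue φ)]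
    exact freeValue_eq_of_mk_eq φ (by simpa [π] using ha)
  · have hw : wordToL K w = π (w.map (FreeAlgebra.ι K)).prod := by
      simp only [π, wordToL, AlgHom.toLinearMap_apply, map_list_prod, List.map_map]
      rfl
    have hsymm : (π.quotKerEquivOfSurjective hπ).symm (wordToL K w) =
        Submodule.Quotient.mk (w.map (FreeAlgebra.ι K)).prod := by
      rw [LinearEquiv.symm_apply_eq, hw]
      rfl
    rw [LinearMap.comp_apply, LinearEquiv.coe_coe, hsymm, Submodule.liftQ_apply, freeValue_prod]

/-- The common extension as an algebra homomorphism on the zero component. -/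
lemma exists_algHom_wordToL (φ : ∀ s, sideAlg K m n s →ₐ[K] C) :
    ∃ h : L0 K m n →ₐ[K] C, ∀ (w : LWord m n) (hw : wordToL K w ∈ L0 K m n),
      h ⟨wordToL K w, hw⟩ = wordValue φ w := by
  obtain ⟨Λ, hΛ⟩ := exists_linearMap_wordToL φ
  have hmul : ∀ a ∈ L0 K m n, ∀ b ∈ L0 K m n, Λ (a * b) = Λ a * Λ b := by
    intro a ha b hb
    replace ha := mem_span_of_mem_L0 ha
    replace hb := mem_span_of_mem_L0 hb
    induction ha, hb using Submodule.span_induction₂ with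
    | mem_mem a b ha hb =>
      obtain ⟨u, hu, rfl⟩ := ha
      obtain ⟨v, -, rfl⟩ := hb
      rw [← wordToL_append, hΛ, hΛ, hΛ, wordValue_append φ v hu]
    | zero_left => simp
    | zero_right => simp
    | add_left _ _ _ _ _ _ h h' => simp [add_mul, h, h']
    | add_right _ _ _ _ _ _ h h' => simp [mul_add, h, h']
    | smul_left _ _ _ _ _ h => simp [h]
    | smul_right _ _ _ _ _ h => simp [h]
  refine ⟨AlgHom.ofLinearMap (Λ ∘ₗ (L0 K m n).val.toLinearMap) ?_ ?_, fun w _ => hΛ w⟩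
  · exact (hΛ []).trans (by simp [wordValue, prodPieces])
  · exact fun a b => hmul a a.2 b b.2

lemma wordValue_of_isPrime (φ : ∀ s, sideAlg K m n s →ₐ[K] C) {s : Bool} {w : LWord m n}
    (hw : w.IsPrime) (hs : w.head?.map Sum.isLeft = some s)
    (hmem : wordToL K w ∈ sideAlg K m n s) : wordValue φ w = φ s ⟨wordToL K w, hmem⟩ := by
  obtain ⟨z, w, rfl⟩ := List.exists_cons_of_ne_nil hw.1
  obtain rfl : z.isLeft = s := by simpa using hs
  rw [wordValue_eq_sideExt φ hw.2.1 hw.staysAbove, sideExt, dif_pos hmem]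

end Extension

/-- `L(m,n)₀` is the free product (coproduct) of its subalgebras
`L(m,n)₀^{xy}` and `L(m,n)₀^{yx}` over `K`: any pair of `K`-algebra homomorphisms from
these subalgebras to a unital `K`-algebra `C` extends uniquely to `L(m,n)₀`. -/
theorem stmt9 (K : Type) [Field K] (m n : ℕ) (hm : 0 < m) (hn : 0 < n) :
    ∃ (h1 : L0xy K m n ≤ L0 K m n) (h2 : L0yx K m n ≤ L0 K m n),
      ∀ (C : Type) [Ring C] [Algebra K C]
        (f : L0xy K m n →ₐ[K] C) (g : L0yx K m n →ₐ[K] C),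
        ∃! h : L0 K m n →ₐ[K] C,
          h.comp (Subalgebra.inclusion h1) = f ∧ h.comp (Subalgebra.inclusion h2) = g := by
  refine ⟨sideAlg_le_L0 true, sideAlg_le_L0 false, fun C _ _ f g => ?_⟩
  let φ : ∀ s, sideAlg K m n s →ₐ[K] C := fun s => match s with
    | true => f
    | false => g
  obtain ⟨h, hh⟩ := exists_algHom_wordToL φ
  have hf : h.comp (Subalgebra.inclusion (sideAlg_le_L0 true)) = f := by
    refine AlgHom.adjoin_ext ?_
    rintro _ ⟨w, hw, ⟨-, ⟨p, hp⟩, -⟩, rfl⟩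
    exact (hh w _).trans (wordValue_of_isPrime φ (s := true) hw (by simp [hp]) _)
  have hg : h.comp (Subalgebra.inclusion (sideAlg_le_L0 false)) = g := by
    refine AlgHom.adjoin_ext ?_
    rintro _ ⟨w, hw, ⟨-, ⟨p, hp⟩, -⟩, rfl⟩
    exact (hh w _).trans (wordValue_of_isPrime φ (s := false) hw (by simp [hp]) _)
  refine ⟨h, ⟨hf, hg⟩, fun h' hh' => ?_⟩
  have hT (s : Bool) :
      sideAlg K m n s ≤ (AlgHom.equalizer h' h).map (L0 K m n).val := by
    intro a ha
    refine ⟨⟨a, sideAlg_le_L0 s ha⟩, ?_, rfl⟩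
    cases s
    · exact (AlgHom.congr_fun hh'.2 ⟨a, ha⟩).trans (AlgHom.congr_fun hg ⟨a, ha⟩).symm
    · exact (AlgHom.congr_fun hh'.1 ⟨a, ha⟩).trans (AlgHom.congr_fun hf ⟨a, ha⟩).symm
  refine AlgHom.adjoin_ext ?_
  rintro _ ⟨w, hw, rfl⟩
  obtain ⟨b, hb, hbw⟩ := wordToL_mem_of_balanced hT hw
  rwa [show b = ⟨wordToL K w, Algebra.subset_adjoin ⟨w, hw, rfl⟩⟩ from Subtype.ext hbw] at hb
end

section
/- The set C^{xy} = { ŵ : w ∈ B^{xy} } of completions of words in B^{xy} (with the completion of the empty word being the empty word) has image in L(m,n) that is a K-linear basis of L(m,n)_0^{xy}. -/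
open scoped BigOperators

/-- The letter `y_{1m}` (0-indexed: `y` with indices `j = 1`, `i = m`). -/
def y1mLetter {m n : ℕ} (hm : 0 < m) (hn : 0 < n) : LGen m n :=
  Sum.inr (⟨0, hn⟩, ⟨m - 1, by omega⟩)

/-- The letter `x_{m1}` (0-indexed: `x` with indices `i = m`, `j = 1`). -/
def xm1Letter {m n : ℕ} (hm : 0 < m) (hn : 0 < n) : LGen m n :=
  Sum.inl (⟨m - 1, by omega⟩, ⟨0, hn⟩)

/-- `BxyData p k Xb Yb r w` : the word `w` lies in `B^{xy}(k 1, …, k p)`, witnessed by its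
block decomposition `w = Xb 1 ++ Yb 1 ++ Xb 2 ++ Yb 2 ++ ⋯ ++ Xb p ++ Yb p`, where
`Xb i` is an x-block of length `k i − r (i−1)` and `Yb i` a y-block of length `k i − r i`,
with `r 0 = r p = 0` and `0 ≤ r i < min (k i) (k (i+1))` for `1 ≤ i ≤ p−1`; moreover `w`
is irreducible and lies in `⟨X⟩₀^{xy}`. -/
def BxyData {m n : ℕ} (p : ℕ) (k : ℕ → ℕ) (Xb Yb : ℕ → LWord m n) (r : ℕ → ℕ)
    (w : LWord m n) : Prop :=
  1 ≤ p ∧ (∀ i, 1 ≤ i → i ≤ p → 1 ≤ k i) ∧ r 0 = 0 ∧ r p = 0 ∧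
  (∀ i, 1 ≤ i → i ≤ p - 1 → r i < min (k i) (k (i + 1))) ∧
  (∀ i, 1 ≤ i → i ≤ p →
    (∀ z ∈ Xb i, z.isLeft = true) ∧ (Xb i).length = k i - r (i - 1) ∧
    (∀ z ∈ Yb i, z.isRight = true) ∧ (Yb i).length = k i - r i) ∧
  w = ((List.range p).map fun i => Xb (i + 1) ++ Yb (i + 1)).flatten ∧
  w.Irr ∧ w.InXY

/-- `w ∈ B^{xy}(k 1, …, k p)`. -/
def BxyMem {m n : ℕ} (p : ℕ) (k : ℕ → ℕ) (w : LWord m n) : Prop :=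
  ∃ Xb Yb r, BxyData p k Xb Yb r w

/-- The completion `ŵ` of a word of `B^{xy}(k 1, …, k p)` with block data `Xb, Yb, r` :
the word `(y_{1m})^{r i} (x_{m1})^{r i}` is inserted after the `i`-th y-block
(for `i < p`; note `r p = 0`, so nothing is inserted at the end). -/
def completionOf {m n : ℕ} (hm : 0 < m) (hn : 0 < n) (p : ℕ)
    (Xb Yb : ℕ → LWord m n) (r : ℕ → ℕ) : LWord m n :=
  ((List.range p).map fun i =>
    Xb (i + 1) ++ Yb (i + 1) ++
      (List.replicate (r (i + 1)) (y1mLetter hm hn) ++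
       List.replicate (r (i + 1)) (xm1Letter hm hn))).flatten

/-- The set `C^{xy} = { ŵ | w ∈ B^{xy} }` of completions of words of `B^{xy}` (the
completion of the empty word being the empty word). -/
def CxySet {m n : ℕ} (hm : 0 < m) (hn : 0 < n) : Set (LWord m n) :=
  {v | v = [] ∨ ∃ (p : ℕ) (k : ℕ → ℕ) (Xb Yb : ℕ → LWord m n) (r : ℕ → ℕ) (w : LWord m n),
    BxyData p k Xb Yb r w ∧ v = completionOf hm hn p Xb Yb r}

section Words

variable {m n : ℕ}

/-- The letter `z` can be put in front of `w` without creating a forbidden pair. -/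
def LWord.Extends (z : LGen m n) (w : LWord m n) : Prop :=
  ∀ z', w.head? = some z' → ¬ LForbidden z z'

lemma irr_nil : LWord.Irr ([] : LWord m n) := by
  intro u v z z' h
  simp at h

lemma irr_cons {z : LGen m n} {w : LWord m n} :
    LWord.Irr (z :: w) ↔ LWord.Extends z w ∧ w.Irr := by
  constructor
  · intro h
    refine ⟨fun z' hz' => ?_, fun u v a b hab => h (z :: u) v a b (by simp [hab])⟩
    obtain ⟨t, rfl⟩ := List.head?_eq_some_iff.1 hz'
    exact h [] t z z' rfl
  · rintro ⟨h1, h2⟩ u v a b hab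
    cases u with
    | nil =>
      simp only [List.nil_append, List.cons.injEq] at hab
      obtain ⟨rfl, rfl⟩ := hab
      exact h1 b rfl
    | cons c u =>
      simp only [List.cons_append, List.cons.injEq] at hab
      exact h2 u v a b hab.2

lemma not_forbidden_inl_inl (p q : Fin m × Fin n) :
    ¬ LForbidden (Sum.inl p : LGen m n) (Sum.inl q) := by
  simp [LForbidden]

lemma not_forbidden_inr_inr (p q : Fin n × Fin m) :
    ¬ LForbidden (Sum.inr p : LGen m n) (Sum.inr q) := by
  simp [LForbidden]

lemma forbidden_inl_inr {i i' : Fin m} {j j' : Fin n} :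
    LForbidden (Sum.inl (i, j) : LGen m n) (Sum.inr (j', i')) ↔ j = j' ∧ (j : ℕ) = n - 1 := by
  constructor
  · rintro (⟨a, b, c, hc, h1, h2⟩ | ⟨a, b, c, hc, h1, h2⟩)
    · simp only [Sum.inl.injEq, Sum.inr.injEq, Prod.mk.injEq] at h1 h2
      obtain ⟨⟨rfl, rfl⟩, rfl, rfl⟩ := And.intro h1 h2
      exact ⟨rfl, hc⟩
    · simp at h1
  · rintro ⟨rfl, h⟩
    exact Or.inl ⟨i, i', j, h, rfl, rfl⟩

lemma forbidden_inr_inl {j j' : Fin n} {i i' : Fin m} :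
    LForbidden (Sum.inr (j, i) : LGen m n) (Sum.inl (i', j')) ↔ i = i' ∧ (i : ℕ) = m - 1 := by
  constructor
  · rintro (⟨a, b, c, hc, h1, h2⟩ | ⟨a, b, c, hc, h1, h2⟩)
    · simp at h1
    · simp only [Sum.inl.injEq, Sum.inr.injEq, Prod.mk.injEq] at h1 h2
      obtain ⟨⟨rfl, rfl⟩, rfl, rfl⟩ := And.intro h1 h2
      exact ⟨rfl, hc⟩
  · rintro ⟨rfl, h⟩
    exact Or.inr ⟨j, j', i, h, rfl, rfl⟩

lemma extends_nil (z : LGen m n) : LWord.Extends z [] := by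
  simp [LWord.Extends]

lemma extends_cons {z z' : LGen m n} {w : LWord m n} :
    LWord.Extends z (z' :: w) ↔ ¬ LForbidden z z' := by
  simp [LWord.Extends]

lemma extends_inl_congr (i i' : Fin m) (j : Fin n) (w : LWord m n) :
    LWord.Extends (Sum.inl (i, j)) w ↔ LWord.Extends (Sum.inl (i', j)) w := by
  rcases w with _ | ⟨⟨a, b⟩ | ⟨a, b⟩, w⟩ <;>
    simp [extends_nil, extends_cons, not_forbidden_inl_inl, forbidden_inl_inr]

lemma extends_inr_congr (j j' : Fin n) (i : Fin m) (w : LWord m n) :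
    LWord.Extends (Sum.inr (j, i)) w ↔ LWord.Extends (Sum.inr (j', i)) w := by
  rcases w with _ | ⟨⟨a, b⟩ | ⟨a, b⟩, w⟩ <;>
    simp [extends_nil, extends_cons, not_forbidden_inr_inr, forbidden_inr_inl]

lemma extends_or_inl (i : Fin m) (j : Fin n) (w : LWord m n) :
    LWord.Extends (Sum.inl (i, j)) w ∨
      ((j : ℕ) = n - 1 ∧ ∃ i' w', w = Sum.inr (j, i') :: w') := by
  rcases w with _ | ⟨⟨a, b⟩ | ⟨a, b⟩, w⟩
  · exact Or.inl (extends_nil _)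
  · exact Or.inl (extends_cons.2 (not_forbidden_inl_inl _ _))
  · rw [extends_cons, forbidden_inl_inr]
    by_cases h : j = a ∧ (j : ℕ) = n - 1
    · obtain ⟨rfl, h⟩ := h
      exact Or.inr ⟨h, b, w, rfl⟩
    · exact Or.inl h

lemma extends_or_inr (j : Fin n) (i : Fin m) (w : LWord m n) :
    LWord.Extends (Sum.inr (j, i)) w ∨
      ((i : ℕ) = m - 1 ∧ ∃ j' w', w = Sum.inl (i, j') :: w') := by
  rcases w with _ | ⟨⟨a, b⟩ | ⟨a, b⟩, w⟩
  · exact Or.inl (extends_nil _)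
  · rw [extends_cons, forbidden_inr_inl]
    by_cases h : i = a ∧ (i : ℕ) = m - 1
    · obtain ⟨rfl, h⟩ := h
      exact Or.inr ⟨h, b, w, rfl⟩
    · exact Or.inl h
  · exact Or.inl (extends_cons.2 (not_forbidden_inr_inr _ _))

/-- `Dyck h w`: reading an x-letter as a step up and a y-letter as a step down, the path
described by `w` starts at height `h`, ends at height `0` and never becomes negative. -/
def LWord.Dyck : ℕ → LWord m n → Prop
  | h, [] => h = 0
  | h, Sum.inl _ :: w => LWord.Dyck (h + 1) w
  | 0, Sum.inr _ :: _ => False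
  | h + 1, Sum.inr _ :: w => LWord.Dyck h w

/-- `Descends h w`: the path described by `w` starts at height `h` and reaches height `0`
for the first time at its end. -/
def LWord.Descends : ℕ → LWord m n → Prop
  | h, [] => h = 0
  | 0, _ :: _ => False
  | h + 1, Sum.inl _ :: w => LWord.Descends (h + 2) w
  | h + 1, Sum.inr _ :: w => LWord.Descends h w

lemma dyck_append {u v : LWord m n} {a b : ℕ} (hu : LWord.Dyck a u) (hv : LWord.Dyck b v) :
    LWord.Dyck (a + b) (u ++ v) := by
  induction u generalizing a with
  | nil =>
    simp only [LWord.Dyck] at hu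
    simpa [hu] using hv
  | cons z u ih =>
    rcases z with p | q
    · have := ih (a := a + 1) hu
      rwa [show a + 1 + b = a + b + 1 by omega] at this
    · cases a with
      | zero => exact hu.elim
      | succ a =>
        rw [show a + 1 + b = a + b + 1 by omega]
        exact ih (a := a) hu

lemma exists_descends_append {w : LWord m n} {h : ℕ} (hw : LWord.Dyck h w) :
    ∃ u v : LWord m n, w = u ++ v ∧ LWord.Descends h u ∧ LWord.Dyck 0 v := by
  induction w generalizing h with
  | nil => exact ⟨[], [], rfl, hw, rfl⟩
  | cons z w ih =>
    cases h with
    | zero => exact ⟨[], z :: w, rfl, rfl, hw⟩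
    | succ h =>
      rcases z with p | q
      · obtain ⟨u, v, rfl, hu, hv⟩ := ih (h := h + 2) hw
        exact ⟨Sum.inl p :: u, v, rfl, hu, hv⟩
      · obtain ⟨u, v, rfl, hu, hv⟩ := ih (h := h) hw
        exact ⟨Sum.inr q :: u, v, rfl, hu, hv⟩

lemma descends_countP {u : LWord m n} {h : ℕ} (hu : LWord.Descends h u) :
    h + u.countP Sum.isLeft = u.countP Sum.isRight := by
  induction u generalizing h with
  | nil => simpa [LWord.Descends] using hu
  | cons z u ih =>
    cases h with
    | zero => exact hu.elim
    | succ h =>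
      rcases z with p | q
      · have := ih (h := h + 2) hu
        simp [List.countP_cons]
        omega
      · have := ih (h := h) hu
        simp [List.countP_cons]
        omega

lemma descends_prefix {a b : LWord m n} {h : ℕ} (hu : LWord.Descends h (a ++ b)) (hb : b ≠ []) :
    a.countP Sum.isRight < h + a.countP Sum.isLeft := by
  induction a generalizing h with
  | nil =>
    cases h with
    | zero =>
      cases b with
      | nil => exact (hb rfl).elim
      | cons => exact hu.elim
    | succ h => simp
  | cons z u ih =>
    cases h with
    | zero => exact hu.elim
    | succ h =>
      rcases z with p | q
      · have := ih (h := h + 2) hu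
        simp [List.countP_cons]
        omega
      · have := ih (h := h) hu
        simp [List.countP_cons]
        omega

lemma descends_getLast {u : LWord m n} {h : ℕ} (hu : LWord.Descends (h + 1) u) :
    ∃ q, u.getLast? = some (Sum.inr q) := by
  induction u generalizing h with
  | nil => simp [LWord.Descends] at hu
  | cons z u ih =>
    rcases z with p | q
    · obtain ⟨q, hq⟩ := ih (h := h + 1) hu
      exact ⟨q, by simp [List.getLast?_cons, hq]⟩
    · cases h with
      | zero =>
        cases u with
        | nil => exact ⟨q, rfl⟩
        | cons => exact hu.elim
      | succ h =>
        obtain ⟨q', hq⟩ := ih (h := h) hu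
        exact ⟨q', by simp [List.getLast?_cons, hq]⟩

lemma isPrime_cons_of_descends {p : Fin m × Fin n} {u : LWord m n} (hu : LWord.Descends 1 u) :
    LWord.IsPrime (Sum.inl p :: u) ∧ LWord.XY (Sum.inl p :: u) := by
  have hbal : LWord.Balanced (Sum.inl p :: u) := by
    have := descends_countP hu
    simp [LWord.Balanced, List.countP_cons]
    omega
  refine ⟨⟨by simp, hbal, ?_⟩, hbal, ⟨p, rfl⟩, ?_⟩
  · intro a b hab ha hb hbala
    cases a with
    | nil => exact ha rfl
    | cons z a =>
      simp only [List.cons_append, List.cons.injEq] at hab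
      obtain ⟨rfl, rfl⟩ := hab
      have := descends_prefix hu hb
      simp [LWord.Balanced, List.countP_cons] at hbala
      omega
  · obtain ⟨q, hq⟩ := descends_getLast hu
    exact ⟨q, by simp [List.getLast?_cons, hq]⟩

lemma inXY_of_dyck {w : LWord m n} (hw : LWord.Dyck 0 w) : w.InXY := by
  induction hN : w.length using Nat.strong_induction_on generalizing w with
  | _ N ih =>
    rcases w with _ | ⟨p | q, w⟩
    · exact ⟨[], by simp, rfl⟩
    · obtain ⟨u, v, rfl, hu, hv⟩ := exists_descends_append (h := 1) hw
      obtain ⟨ws, hws, hflat⟩ := ih v.length (by simp at hN; omega) hv rfl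
      refine ⟨(Sum.inl p :: u) :: ws, ?_, by simp [hflat]⟩
      rintro a (_ | ⟨_, ha⟩)
      · exact isPrime_cons_of_descends hu
      · exact hws a ha
    · exact hw.elim

lemma dyck_of_prefix_ne {u : LWord m n} {h : ℕ}
    (hpre : ∀ a b : LWord m n, u = a ++ b → b ≠ [] →
      h + a.countP Sum.isLeft ≠ a.countP Sum.isRight)
    (htot : h + u.countP Sum.isLeft = u.countP Sum.isRight) : LWord.Dyck h u := by
  induction u generalizing h with
  | nil => simpa [LWord.Dyck] using htot
  | cons z u ih =>
    have h0 : h ≠ 0 := by simpa using hpre [] (z :: u) rfl (by simp)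
    obtain ⟨h, rfl⟩ := Nat.exists_eq_succ_of_ne_zero h0
    rcases z with p | q
    · refine ih (h := h + 1 + 1) (fun a b hab hb => ?_) ?_
      · have := hpre (Sum.inl p :: a) b (by simp [hab]) hb
        simp [List.countP_cons] at this
        omega
      · simp [List.countP_cons] at htot
        omega
    · refine ih (h := h) (fun a b hab hb => ?_) ?_
      · have := hpre (Sum.inr q :: a) b (by simp [hab]) hb
        simp [List.countP_cons] at this
        omega
      · simp [List.countP_cons] at htot
        omega

lemma dyck_of_isPrime {u : LWord m n} (hp : u.IsPrime) (hxy : u.XY) : LWord.Dyck 0 u := by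
  obtain ⟨-, ⟨p, hhead⟩, -⟩ := hxy
  obtain ⟨-, hbal, hprime⟩ := hp
  obtain ⟨t, rfl⟩ := List.head?_eq_some_iff.1 hhead
  refine dyck_of_prefix_ne (h := 1) (fun a b hab hb => ?_) ?_
  · have := hprime (Sum.inl p :: a) b (by simp [hab]) (by simp) hb
    simp [LWord.Balanced, List.countP_cons] at this
    omega
  · simp [LWord.Balanced, List.countP_cons] at hbal
    omega

lemma dyck_of_inXY {w : LWord m n} (hw : w.InXY) : LWord.Dyck 0 w := by
  obtain ⟨ws, hws, rfl⟩ := hw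
  induction ws with
  | nil => rfl
  | cons u ws ih =>
    have hu := hws u (by simp)
    exact dyck_append (a := 0) (b := 0) (dyck_of_isPrime hu.1 hu.2)
      (ih fun v hv => hws v (by simp [hv]))

/-- The word inserted by the completion in front of `w` at a point of height `h`. -/
def LWord.valley (hm : 0 < m) (hn : 0 < n) (h : ℕ) : LWord m n → LWord m n
  | Sum.inl _ :: _ => List.replicate h (y1mLetter hm hn) ++ List.replicate h (xm1Letter hm hn)
  | _ => []

/-- The completion of a word starting at height `h`: at each valley of the path, a descent to
height `0` followed by an ascent is inserted. -/
def LWord.completion (hm : 0 < m) (hn : 0 < n) : ℕ → LWord m n → LWord m n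
  | _, [] => []
  | h, Sum.inl p :: w => Sum.inl p :: LWord.completion hm hn (h + 1) w
  | h, Sum.inr q :: w =>
    Sum.inr q :: (LWord.valley hm hn (h - 1) w ++ LWord.completion hm hn (h - 1) w)

lemma length_le_completion (hm : 0 < m) (hn : 0 < n) (h : ℕ) (w : LWord m n) :
    w.length ≤ (w.completion hm hn h).length := by
  induction w generalizing h with
  | nil => simp
  | cons z w ih =>
    rcases z with p | q
    · simpa [LWord.completion] using ih (h + 1)
    · have := ih (h - 1)
      simp [LWord.completion]
      omega

lemma valley_congr (hm : 0 < m) (hn : 0 < n) (h : ℕ) {u w : LWord m n}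
    (huw : u.head? = w.head?) : u.valley hm hn h = w.valley hm hn h := by
  rcases u with _ | ⟨p | q, u⟩ <;> rcases w with _ | ⟨p' | q', w⟩ <;>
    simp [LWord.valley] at huw ⊢

lemma completion_append_left (hm : 0 < m) (hn : 0 < n) {X w : LWord m n} {h : ℕ}
    (hX : ∀ z ∈ X, z.isLeft = true) :
    (X ++ w).completion hm hn h = X ++ w.completion hm hn (h + X.length) := by
  induction X generalizing h with
  | nil => rfl
  | cons z X ih =>
    rcases z with p | q
    · simp [LWord.completion, ih fun z hz => hX z (by simp [hz]), add_assoc, add_comm 1]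
    · simpa using hX (Sum.inr q) (by simp)

lemma completion_append_right (hm : 0 < m) (hn : 0 < n) {Y w : LWord m n} {h : ℕ}
    (hY : ∀ z ∈ Y, z.isRight = true) (hne : Y ≠ []) :
    (Y ++ w).completion hm hn h =
      Y ++ (w.valley hm hn (h - Y.length) ++ w.completion hm hn (h - Y.length)) := by
  induction Y generalizing h with
  | nil => exact (hne rfl).elim
  | cons z Y ih =>
    rcases z with p | q
    · simpa using hY (Sum.inl p) (by simp)
    · cases Y with
      | nil => simp [LWord.completion]
      | cons z' Y =>
        have hz' : LWord.valley hm hn (h - 1) (z' :: (Y ++ w)) = [] := by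
          rcases z' with p' | q'
          · simpa using hY (Sum.inl p') (by simp)
          · rfl
        have := ih (h := h - 1) (fun z hz => hY z (by simp [hz])) (by simp)
        rw [show h - 1 - (z' :: Y).length = h - (Sum.inr q :: z' :: Y).length by
          simp; omega] at this
        rw [List.cons_append, LWord.completion, this,
          show z' :: Y ++ w = z' :: (Y ++ w) from rfl, hz']
        rfl

/-- A decomposition of a path starting at height `r 0` into `p` ascending blocks `X i` and
descending blocks `Y i`, with peaks of height `k i` and valleys of height `r (i + 1)`. -/
def BlockDecomp (p : ℕ) (k : ℕ → ℕ) (X Y : ℕ → LWord m n) (r : ℕ → ℕ) : Prop :=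
  r p = 0 ∧ ∀ i < p, (∀ z ∈ X i, z.isLeft = true) ∧ (X i).length = k i - r i ∧
    (∀ z ∈ Y i, z.isRight = true) ∧ (Y i).length = k i - r (i + 1) ∧
    r i < k i ∧ r (i + 1) < k i

lemma completion_blocks (hm : 0 < m) (hn : 0 < n) {p : ℕ} {k : ℕ → ℕ} {X Y : ℕ → LWord m n}
    {r : ℕ → ℕ} (hd : BlockDecomp p k X Y r) :
    LWord.completion hm hn (r 0) ((List.range p).map fun i => X i ++ Y i).flatten =
      ((List.range p).map fun i => X i ++ Y i ++
        (List.replicate (r (i + 1)) (y1mLetter hm hn) ++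
          List.replicate (r (i + 1)) (xm1Letter hm hn))).flatten := by
  induction p generalizing k X Y r with
  | zero => rfl
  | succ p ih =>
    have hshift : BlockDecomp p (fun i => k (i + 1)) (fun i => X (i + 1)) (fun i => Y (i + 1))
        (fun i => r (i + 1)) := ⟨hd.1, fun i hi => hd.2 (i + 1) (by omega)⟩
    obtain ⟨hX, hXl, hY, hYl, hr0, hr1⟩ := hd.2 0 (by omega)
    have hih := ih hshift
    have hYne : Y 0 ≠ [] := by
      rw [← List.length_pos_iff]
      omega
    simp only [List.range_succ_eq_map, List.map_cons, List.map_map, List.flatten_cons,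
      Function.comp_def, List.append_assoc] at hih ⊢
    rw [completion_append_left hm hn hX, completion_append_right hm hn hY hYne]
    have hheight : r 0 + (X 0).length - (Y 0).length = r 1 := by
      rw [zero_add] at hYl hr1
      omega
    simp only [Nat.succ_eq_add_one, zero_add] at hih ⊢
    rw [hheight, hih]
    congr 2
    rw [← List.append_assoc]
    congr 1
    cases p with
    | zero =>
      have := hd.1
      simp at this
      simp [this, LWord.valley]
    | succ p =>
      obtain ⟨hX', hXl', -, -, hr0', -⟩ := hd.2 1 (by omega)
      rcases hX1 : X 1 with _ | ⟨p' | q', t⟩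
      · rw [hX1] at hXl'
        simp at hXl'
        omega
      · simp [List.range_succ_eq_map, hX1, LWord.valley]
      · rw [hX1] at hX'
        simpa using hX' (Sum.inr q') (by simp)

lemma exists_right_block {w : LWord m n} {h : ℕ} (hw : LWord.Dyck h w) :
    ∃ Y w' : LWord m n, w = Y ++ w' ∧ (∀ z ∈ Y, z.isRight = true) ∧ Y.length ≤ h ∧
      LWord.Dyck (h - Y.length) w' ∧ (∀ q, w'.head? ≠ some (Sum.inr q)) ∧
      ((∃ q, w.head? = some (Sum.inr q)) → Y ≠ []) := by
  induction w generalizing h with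
  | nil => exact ⟨[], [], rfl, by simp, by simp, hw, by simp, by simp⟩
  | cons z w ih =>
    rcases z with p | q
    · exact ⟨[], Sum.inl p :: w, rfl, by simp, by simp, hw, by simp, by simp⟩
    · cases h with
      | zero => exact hw.elim
      | succ h =>
        obtain ⟨Y, w', rfl, hY, hl, hw', hhead, -⟩ := ih (h := h) hw
        refine ⟨Sum.inr q :: Y, w', rfl, ?_, by simpa using hl, by simpa using hw', hhead,
          by simp⟩
        rintro z (_ | ⟨_, hz⟩)
        · rfl
        · exact hY z hz

lemma exists_left_block {w : LWord m n} {h : ℕ} (hw : LWord.Dyck h w) (hne : w ≠ []) :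
    ∃ X w' : LWord m n, w = X ++ w' ∧ (∀ z ∈ X, z.isLeft = true) ∧
      LWord.Dyck (h + X.length) w' ∧ (∃ q, w'.head? = some (Sum.inr q)) ∧
      ((∀ q, w.head? ≠ some (Sum.inr q)) → X ≠ []) := by
  induction w generalizing h with
  | nil => exact (hne rfl).elim
  | cons z w ih =>
    rcases z with p | q
    · have hw0 : w ≠ [] := by
        rintro rfl
        simp [LWord.Dyck] at hw
      obtain ⟨X, w', rfl, hX, hw', hhead, -⟩ := ih (h := h + 1) hw hw0
      refine ⟨Sum.inl p :: X, w', rfl, ?_, ?_, hhead, by simp⟩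
      · rintro z (_ | ⟨_, hz⟩)
        · rfl
        · exact hX z hz
      · rwa [List.length_cons, show h + (X.length + 1) = h + 1 + X.length by omega]
    · exact ⟨[], Sum.inr q :: w, rfl, by simp, hw, ⟨q, rfl⟩, by simp⟩

lemma exists_blockDecomp {w : LWord m n} {h : ℕ} (hw : LWord.Dyck h w)
    (hhead : ∀ q, w.head? ≠ some (Sum.inr q)) :
    ∃ (p : ℕ) (k : ℕ → ℕ) (X Y : ℕ → LWord m n) (r : ℕ → ℕ), BlockDecomp p k X Y r ∧
      r 0 = h ∧ w = ((List.range p).map fun i => X i ++ Y i).flatten := by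
  induction hN : w.length using Nat.strong_induction_on generalizing w h with
  | _ N ih =>
    by_cases hne : w = []
    · subst hne
      exact ⟨0, fun _ => 0, fun _ => [], fun _ => [], fun _ => h, ⟨hw, by simp⟩, rfl, rfl⟩
    · obtain ⟨X₀, w₁, rfl, hX, hw₁, hhead₁, hXne⟩ := exists_left_block hw hne
      obtain ⟨Y₀, w₂, rfl, hY, hYl, hw₂, hhead₂, hYne⟩ := exists_right_block hw₁
      have hXpos := List.length_pos_iff.2 (hXne hhead)
      have hYpos := List.length_pos_iff.2 (hYne hhead₁)
      obtain ⟨p, k, X, Y, r, ⟨hrp, hd⟩, hr0, rfl⟩ :=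
        ih w₂.length (by simp at hN; omega) hw₂ hhead₂ rfl
      refine ⟨p + 1, fun i => Nat.casesOn i (h + X₀.length) k, fun i => Nat.casesOn i X₀ X,
        fun i => Nat.casesOn i Y₀ Y, fun i => Nat.casesOn i h r, ⟨hrp, ?_⟩, rfl, ?_⟩
      · rintro (_ | i) hi
        · refine ⟨hX, ?_, hY, ?_, ?_, ?_⟩
          · show X₀.length = h + X₀.length - h
            omega
          · show Y₀.length = h + X₀.length - r 0
            omega
          · show h < h + X₀.length
            omega
          · show r 0 < h + X₀.length
            omega
        · exact hd i (by omega)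
      · simp [List.range_succ_eq_map, Function.comp_def]

lemma mem_CxySet_iff (hm : 0 < m) (hn : 0 < n) {v : LWord m n} :
    v ∈ CxySet hm hn ↔
      ∃ w : LWord m n, w.Irr ∧ LWord.Dyck 0 w ∧ v = w.completion hm hn 0 := by
  constructor
  · rintro (rfl | ⟨p, k, Xb, Yb, r, w, ⟨hp, hk, hr0, hrp, hr, hb, hw, hirr, hxy⟩, rfl⟩)
    · exact ⟨[], irr_nil, rfl, rfl⟩
    · refine ⟨w, hirr, dyck_of_inXY hxy, ?_⟩
      have hd : BlockDecomp p (fun i => k (i + 1)) (fun i => Xb (i + 1))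
          (fun i => Yb (i + 1)) r := by
        refine ⟨hrp, fun i hi => ?_⟩
        obtain ⟨h1, h2, h3, h4⟩ := hb (i + 1) (by omega) (by omega)
        refine ⟨h1, h2, h3, h4, ?_, ?_⟩
        · rcases Nat.eq_zero_or_pos i with rfl | hi0
          · have := hk 1 le_rfl hp
            simp
            omega
          · have := hr i hi0 (by omega)
            simp only [lt_min_iff] at this
            exact this.2
        · by_cases hip : i + 1 = p
          · have := hk (i + 1) (by omega) (by omega)
            rw [hip, hrp]
            exact this
          · have := hr (i + 1) (by omega) (by omega)
            simp only [lt_min_iff] at this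
            exact this.1
      have := completion_blocks hm hn hd
      rw [hr0] at this
      rw [hw, this]
      rfl
  · rintro ⟨w, hirr, hw, rfl⟩
    by_cases hne : w = []
    · subst hne
      exact Or.inl rfl
    · have hhead : ∀ q, w.head? ≠ some (Sum.inr q) := by
        intro q hq
        obtain ⟨t, rfl⟩ := List.head?_eq_some_iff.1 hq
        exact hw.elim
      obtain ⟨p, k, X, Y, r, hd, hr0, hflat⟩ := exists_blockDecomp hw hhead
      refine Or.inr ⟨p, fun i => k (i - 1), fun i => X (i - 1), fun i => Y (i - 1), r, w,
        ⟨?_, ?_, hr0, hd.1, ?_, ?_, by simpa using hflat, hirr, inXY_of_dyck hw⟩, ?_⟩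
      · rcases Nat.eq_zero_or_pos p with rfl | hp
        · exact (hne hflat).elim
        · exact hp
      · intro i h1 hi
        have := (hd.2 (i - 1) (by omega)).2.2.2.2.1
        show 1 ≤ k (i - 1)
        omega
      · intro i h1 hi
        have h2 := (hd.2 (i - 1) (by omega)).2.2.2.2.2
        have h3 := (hd.2 i (by omega)).2.2.2.2.1
        rw [Nat.sub_add_cancel h1] at h2
        simpa using ⟨h2, h3⟩
      · intro i h1 hi
        obtain ⟨a, b, c, d, -⟩ := hd.2 (i - 1) (by omega)
        rw [Nat.sub_add_cancel h1] at d
        exact ⟨a, b, c, d⟩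
      · have := completion_blocks hm hn hd
        rw [hr0, ← hflat] at this
        rw [this]
        simp [completionOf]

end Words

section Independence

variable (K : Type) [Field K] {m n : ℕ}

/-- The normal form of the product of the letter `z` with an irreducible word. -/
noncomputable def mulLetter : LGen m n → LWord m n → (LWord m n →₀ K)
  | Sum.inl (i, j), Sum.inr (j', i') :: w =>
    if j = j' ∧ (j : ℕ) = n - 1 then
      (if i = i' then Finsupp.single w 1 else 0) -
        ∑ a ∈ Finset.univ.erase j, Finsupp.single (Sum.inl (i, a) :: Sum.inr (a, i') :: w) 1
    else Finsupp.single (Sum.inl (i, j) :: Sum.inr (j', i') :: w) 1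
  | Sum.inr (j, i), Sum.inl (i', j') :: w =>
    if i = i' ∧ (i : ℕ) = m - 1 then
      (if j = j' then Finsupp.single w 1 else 0) -
        ∑ a ∈ Finset.univ.erase i, Finsupp.single (Sum.inr (j, a) :: Sum.inl (a, j') :: w) 1
    else Finsupp.single (Sum.inr (j, i) :: Sum.inl (i', j') :: w) 1
  | z, w => Finsupp.single (z :: w) 1

lemma mulLetter_of_extends {z : LGen m n} {w : LWord m n} (h : LWord.Extends z w) :
    mulLetter K z w = Finsupp.single (z :: w) 1 := by
  rcases z with ⟨i, j⟩ | ⟨j, i⟩ <;> rcases w with _ | ⟨⟨i', j'⟩ | ⟨j', i'⟩, w⟩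
  · rfl
  · rfl
  · rw [extends_cons, forbidden_inl_inr] at h
    simp only [mulLetter, if_neg h]
  · rfl
  · rw [extends_cons, forbidden_inr_inl] at h
    simp only [mulLetter, if_neg h]
  · rfl

lemma mulLetter_inl {i i' : Fin m} {j : Fin n} {w : LWord m n} (hj : (j : ℕ) = n - 1) :
    mulLetter K (Sum.inl (i, j)) (Sum.inr (j, i') :: w) =
      (if i = i' then Finsupp.single w 1 else 0) -
        ∑ a ∈ Finset.univ.erase j, Finsupp.single (Sum.inl (i, a) :: Sum.inr (a, i') :: w) 1 := by
  simp [mulLetter, hj]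

lemma mulLetter_inr {j j' : Fin n} {i : Fin m} {w : LWord m n} (hi : (i : ℕ) = m - 1) :
    mulLetter K (Sum.inr (j, i)) (Sum.inl (i, j') :: w) =
      (if j = j' then Finsupp.single w 1 else 0) -
        ∑ a ∈ Finset.univ.erase i, Finsupp.single (Sum.inr (j, a) :: Sum.inl (a, j') :: w) 1 := by
  simp [mulLetter, hi]

lemma ne_last_of_mem_erase {N : ℕ} {a b : Fin N} (hb : (b : ℕ) = N - 1)
    (ha : a ∈ Finset.univ.erase b) : ¬ (a : ℕ) = N - 1 :=
  fun h => Finset.ne_of_mem_erase ha (Fin.ext (h.trans hb.symm))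

/-- If `y_{ji'} w` is irreducible and `a` is not maximal, so is `x_{ia} y_{ai'} w`. -/
lemma irr_inl_inr {i i' : Fin m} {a j : Fin n} {w : LWord m n} (ha : ¬ (a : ℕ) = n - 1)
    (hw : LWord.Irr (Sum.inr (j, i') :: w)) :
    LWord.Irr (Sum.inl (i, a) :: Sum.inr (a, i') :: w) := by
  rw [irr_cons] at hw
  rw [irr_cons, irr_cons, extends_cons, forbidden_inl_inr]
  exact ⟨fun h => ha h.2, (extends_inr_congr _ _ _ _).1 hw.1, hw.2⟩

/-- If `x_{ij'} w` is irreducible and `a` is not maximal, so is `y_{ja} x_{aj'} w`. -/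
lemma irr_inr_inl {j j' : Fin n} {a i : Fin m} {w : LWord m n} (ha : ¬ (a : ℕ) = m - 1)
    (hw : LWord.Irr (Sum.inl (i, j') :: w)) :
    LWord.Irr (Sum.inr (j, a) :: Sum.inl (a, j') :: w) := by
  rw [irr_cons] at hw
  rw [irr_cons, irr_cons, extends_cons, forbidden_inr_inl]
  exact ⟨fun h => ha h.2, (extends_inl_congr _ _ _ _).1 hw.1, hw.2⟩

/-- The free module on irreducible words. -/
abbrev irrModule (m n : ℕ) : Submodule K (LWord m n →₀ K) :=
  Finsupp.supported K K {w | w.Irr}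

lemma mulLetter_mem (z : LGen m n) {w : LWord m n} (hw : w.Irr) :
    mulLetter K z w ∈ irrModule K m n := by
  have key : LWord.Extends z w → mulLetter K z w ∈ irrModule K m n := fun h => by
    rw [mulLetter_of_extends K h]
    exact Finsupp.single_mem_supported K _ (irr_cons.2 ⟨h, hw⟩)
  rcases z with ⟨i, j⟩ | ⟨j, i⟩
  · rcases extends_or_inl i j w with h | ⟨hj, i', w, rfl⟩
    · exact key h
    · rw [mulLetter_inl K hj]
      refine Submodule.sub_mem _ ?_ (Submodule.sum_mem _ fun a ha => ?_)
      · split_ifs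
        · exact Finsupp.single_mem_supported K _ (irr_cons.1 hw).2
        · exact Submodule.zero_mem _
      · exact Finsupp.single_mem_supported K _ (irr_inl_inr (ne_last_of_mem_erase hj ha) hw)
  · rcases extends_or_inr j i w with h | ⟨hi, j', w, rfl⟩
    · exact key h
    · rw [mulLetter_inr K hi]
      refine Submodule.sub_mem _ ?_ (Submodule.sum_mem _ fun a ha => ?_)
      · split_ifs
        · exact Finsupp.single_mem_supported K _ (irr_cons.1 hw).2
        · exact Submodule.zero_mem _
      · exact Finsupp.single_mem_supported K _ (irr_inr_inl (ne_last_of_mem_erase hi ha) hw)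

/-- The linear extension of `mulLetter K z`. -/
noncomputable def letterMap (z : LGen m n) : (LWord m n →₀ K) →ₗ[K] (LWord m n →₀ K) :=
  Finsupp.linearCombination K (mulLetter K z)

@[simp]
lemma letterMap_single (z : LGen m n) (w : LWord m n) :
    letterMap K z (Finsupp.single w 1) = mulLetter K z w := by
  simp [letterMap]

lemma letterMap_mem (z : LGen m n) {f : LWord m n →₀ K} (hf : f ∈ irrModule K m n) :
    letterMap K z f ∈ irrModule K m n := by
  rw [letterMap, Finsupp.linearCombination_apply]
  exact Submodule.sum_mem _ fun w hw => Submodule.smul_mem _ _ (mulLetter_mem K z (hf hw))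

/-- The action of a letter on the free module on irreducible words. -/
noncomputable def letterEnd (z : LGen m n) : Module.End K (irrModule K m n) :=
  (letterMap K z).restrict fun _ hf => letterMap_mem K z hf

lemma sum_letterMap_xy_of_extends (hn : 0 < n) (i i' : Fin m) {w : LWord m n}
    (h : ∀ j, LWord.Extends (Sum.inr (j, i')) w) :
    ∑ j : Fin n, letterMap K (Sum.inl (i, j)) (mulLetter K (Sum.inr (j, i')) w) =
      if i = i' then Finsupp.single w 1 else 0 := by
  let l : Fin n := ⟨n - 1, by omega⟩
  have hl : (l : ℕ) = n - 1 := rfl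
  rw [← Finset.add_sum_erase _ _ (Finset.mem_univ l), mulLetter_of_extends K (h l),
    letterMap_single, mulLetter_inl K hl, sub_add_eq_add_sub, sub_eq_iff_eq_add]
  congr 1
  refine Finset.sum_congr rfl fun a ha => ?_
  rw [mulLetter_of_extends K (h a), letterMap_single, mulLetter_of_extends]
  rw [extends_cons, forbidden_inl_inr]
  exact fun h => ne_last_of_mem_erase hl ha h.2

lemma sum_letterMap_yx_of_extends (hm : 0 < m) (j j' : Fin n) {w : LWord m n}
    (h : ∀ i, LWord.Extends (Sum.inl (i, j')) w) :
    ∑ i : Fin m, letterMap K (Sum.inr (j, i)) (mulLetter K (Sum.inl (i, j')) w) =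
      if j = j' then Finsupp.single w 1 else 0 := by
  let l : Fin m := ⟨m - 1, by omega⟩
  have hl : (l : ℕ) = m - 1 := rfl
  rw [← Finset.add_sum_erase _ _ (Finset.mem_univ l), mulLetter_of_extends K (h l),
    letterMap_single, mulLetter_inr K hl, sub_add_eq_add_sub, sub_eq_iff_eq_add]
  congr 1
  refine Finset.sum_congr rfl fun a ha => ?_
  rw [mulLetter_of_extends K (h a), letterMap_single, mulLetter_of_extends]
  rw [extends_cons, forbidden_inr_inl]
  exact fun h => ne_last_of_mem_erase hl ha h.2

lemma sum_letterMap_xy (hn : 0 < n) (i i' : Fin m) {w : LWord m n} (hw : w.Irr) :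
    ∑ j : Fin n, letterMap K (Sum.inl (i, j)) (mulLetter K (Sum.inr (j, i')) w) =
      if i = i' then Finsupp.single w 1 else 0 := by
  rcases extends_or_inr ⟨0, hn⟩ i' w with h | ⟨hi, j', w, rfl⟩
  · exact sum_letterMap_xy_of_extends K hn i i' fun j => (extends_inr_congr _ _ _ _).1 h
  · have hlast := (irr_cons.1 hw).1
    have hterm (a : Fin m) (ha : a ∈ Finset.univ.erase i') :
        ∑ j : Fin n, letterMap K (Sum.inl (i, j))
          (Finsupp.single (Sum.inr (j, a) :: Sum.inl (a, j') :: w) 1) =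
          if i = a then Finsupp.single (Sum.inl (a, j') :: w) 1 else 0 := by
      have hext (j : Fin n) : LWord.Extends (Sum.inr (j, a)) (Sum.inl (a, j') :: w) := by
        rw [extends_cons, forbidden_inr_inl]
        exact fun h => ne_last_of_mem_erase hi ha h.2
      rw [← sum_letterMap_xy_of_extends K hn i a hext]
      exact Finset.sum_congr rfl fun j _ => by rw [mulLetter_of_extends K (hext j)]
    simp only [mulLetter_inr K hi, map_sub, map_sum, Finset.sum_sub_distrib]
    rw [Finset.sum_comm, Finset.sum_congr rfl hterm]
    have hfirst : ∑ j : Fin n, letterMap K (Sum.inl (i, j))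
        (if j = j' then Finsupp.single w 1 else 0) =
          Finsupp.single (Sum.inl (i, j') :: w) 1 := by
      rw [Finset.sum_eq_single j']
      · rw [if_pos rfl, letterMap_single,
          mulLetter_of_extends K ((extends_inl_congr _ _ _ _).1 hlast)]
      · intro b _ hb
        rw [if_neg hb, map_zero]
      · simp
    rw [hfirst]
    by_cases hii : i = i'
    · subst hii
      simp
    · simp [hii]

lemma sum_letterMap_yx (hm : 0 < m) (j j' : Fin n) {w : LWord m n} (hw : w.Irr) :
    ∑ i : Fin m, letterMap K (Sum.inr (j, i)) (mulLetter K (Sum.inl (i, j')) w) =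
      if j = j' then Finsupp.single w 1 else 0 := by
  rcases extends_or_inl ⟨0, hm⟩ j' w with h | ⟨hj, i', w, rfl⟩
  · exact sum_letterMap_yx_of_extends K hm j j' fun i => (extends_inl_congr _ _ _ _).1 h
  · have hlast := (irr_cons.1 hw).1
    have hterm (a : Fin n) (ha : a ∈ Finset.univ.erase j') :
        ∑ i : Fin m, letterMap K (Sum.inr (j, i))
          (Finsupp.single (Sum.inl (i, a) :: Sum.inr (a, i') :: w) 1) =
          if j = a then Finsupp.single (Sum.inr (a, i') :: w) 1 else 0 := by
      have hext (i : Fin m) : LWord.Extends (Sum.inl (i, a)) (Sum.inr (a, i') :: w) := by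
        rw [extends_cons, forbidden_inl_inr]
        exact fun h => ne_last_of_mem_erase hj ha h.2
      rw [← sum_letterMap_yx_of_extends K hm j a hext]
      exact Finset.sum_congr rfl fun i _ => by rw [mulLetter_of_extends K (hext i)]
    simp only [mulLetter_inl K hj, map_sub, map_sum, Finset.sum_sub_distrib]
    rw [Finset.sum_comm, Finset.sum_congr rfl hterm]
    have hfirst : ∑ i : Fin m, letterMap K (Sum.inr (j, i))
        (if i = i' then Finsupp.single w 1 else 0) =
          Finsupp.single (Sum.inr (j, i') :: w) 1 := by
      rw [Finset.sum_eq_single i']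
      · rw [if_pos rfl, letterMap_single,
          mulLetter_of_extends K ((extends_inr_congr _ _ _ _).1 hlast)]
      · intro b _ hb
        rw [if_neg hb, map_zero]
      · simp
    rw [hfirst]
    by_cases hjj : j = j'
    · subst hjj
      simp
    · simp [hjj]

/-- Linear endomorphisms of the irreducible module are determined on irreducible words. -/
lemma irrModule_end_ext {f g : Module.End K (irrModule K m n)}
    (h : ∀ (w : LWord m n) (hw : w.Irr),
      f ⟨Finsupp.single w 1, Finsupp.single_mem_supported K 1 hw⟩ =
        g ⟨Finsupp.single w 1, Finsupp.single_mem_supported K 1 hw⟩) : f = g := by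
  refine LinearMap.ext fun ⟨x, hx⟩ => ?_
  have hx' := hx
  rw [irrModule, Finsupp.supported_eq_span_single] at hx'
  induction hx' using Submodule.span_induction with
  | mem x hmem =>
    obtain ⟨w, hw, rfl⟩ := hmem
    exact h w hw
  | zero => exact (map_zero f).trans (map_zero g).symm
  | add x y hx1 hy1 ihx ihy =>
    rw [← Finsupp.supported_eq_span_single] at hx1 hy1
    have := congrArg₂ (· + ·) (ihx hx1) (ihy hy1)
    simp only [← map_add] at this
    exact this
  | smul c x hx1 ihx =>
    rw [← Finsupp.supported_eq_span_single] at hx1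
    have := congrArg (c • ·) (ihx hx1)
    simp only [← map_smul] at this
    exact this

/-- The representation of the Leavitt algebra on the free module on irreducible words. -/
noncomputable def leavittRep (hm : 0 < m) (hn : 0 < n) :
    Leavitt K m n →ₐ[K] Module.End K (irrModule K m n) :=
  RingQuot.liftAlgHom K ⟨FreeAlgebra.lift K (letterEnd K), by
    rintro _ _ (⟨i, i'⟩ | ⟨j, j'⟩)
    · refine irrModule_end_ext K fun w hw => Subtype.ext ?_
      have := sum_letterMap_xy K hn i i' hw
      split_ifs at this ⊢ <;>
        simpa [letterEnd, LinearMap.sum_apply] using this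
    · refine irrModule_end_ext K fun w hw => Subtype.ext ?_
      have := sum_letterMap_yx K hm j j' hw
      split_ifs at this ⊢ <;>
        simpa [letterEnd, LinearMap.sum_apply] using this⟩

/-- The normal form of an element of the Leavitt algebra. -/
noncomputable def normalForm (hm : 0 < m) (hn : 0 < n) :
    Leavitt K m n →ₗ[K] (LWord m n →₀ K) :=
  (irrModule K m n).subtype ∘ₗ
    LinearMap.applyₗ (⟨Finsupp.single [] 1, Finsupp.single_mem_supported K 1 irr_nil⟩ :
      irrModule K m n) ∘ₗ (leavittRep K hm hn).toLinearMap

lemma normalForm_lgen_mul (hm : 0 < m) (hn : 0 < n) (z : LGen m n) (a : Leavitt K m n) :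
    normalForm K hm hn (lgen K z * a) = letterMap K z (normalForm K hm hn a) := by
  simp [normalForm, lgen, leavittRep, RingQuot.liftAlgHom_mkAlgHom_apply, letterEnd]

lemma normalForm_wordToL (hm : 0 < m) (hn : 0 < n) {w : LWord m n} (hw : w.Irr) :
    normalForm K hm hn (wordToL K w) = Finsupp.single w 1 := by
  induction w with
  | nil => simp [wordToL, normalForm]
  | cons z w ih =>
    obtain ⟨hz, hw⟩ := irr_cons.1 hw
    have : wordToL K (z :: w) = lgen K z * wordToL K w := by simp [wordToL]
    rw [this, normalForm_lgen_mul, ih hw, letterMap_single, mulLetter_of_extends K hz]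

end Independence

section Spanning

variable (K : Type) [Field K] {m n : ℕ}

lemma wordToL_cons (z : LGen m n) (w : LWord m n) :
    wordToL K (z :: w) = lgen K z * wordToL K w := by
  simp [wordToL]

lemma lgen_inl_mul_inr (i i' : Fin m) (j : Fin n) :
    lgen K (Sum.inl (i, j)) * lgen K (Sum.inr (j, i')) =
      (if i = i' then 1 else 0) -
        ∑ a ∈ Finset.univ.erase j, lgen K (Sum.inl (i, a)) * lgen K (Sum.inr (a, i')) := by
  have h := RingQuot.mkAlgHom_rel K (LRel.xy (K := K) (n := n) i i')
  rw [← Finset.add_sum_erase _ _ (Finset.mem_univ j)] at h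
  rw [eq_sub_iff_add_eq]
  split_ifs at h ⊢ <;> simpa [lgen] using h

lemma lgen_inr_mul_inl (j j' : Fin n) (i : Fin m) :
    lgen K (Sum.inr (j, i)) * lgen K (Sum.inl (i, j')) =
      (if j = j' then 1 else 0) -
        ∑ a ∈ Finset.univ.erase i, lgen K (Sum.inr (j, a)) * lgen K (Sum.inl (a, j')) := by
  have h := RingQuot.mkAlgHom_rel K (LRel.yx (K := K) (m := m) j j')
  rw [← Finset.add_sum_erase _ _ (Finset.mem_univ i)] at h
  rw [eq_sub_iff_add_eq]
  split_ifs at h ⊢ <;> simpa [lgen] using h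

lemma lgen_mul_mem_span_image (z : LGen m n) {P Q : LWord m n → Prop} {a : Leavitt K m n}
    (h : ∀ u, P u → lgen K z * wordToL K u ∈ Submodule.span K (wordToL K '' {u | Q u}))
    (ha : a ∈ Submodule.span K (wordToL K '' {u | P u})) :
    lgen K z * a ∈ Submodule.span K (wordToL K '' {u | Q u}) := by
  induction ha using Submodule.span_induction with
  | mem x hx =>
    obtain ⟨u, hu, rfl⟩ := hx
    exact h u hu
  | zero => simp
  | add x y _ _ hx hy =>
    rw [mul_add]
    exact Submodule.add_mem _ hx hy
  | smul c x _ hx =>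
    rw [mul_smul_comm]
    exact Submodule.smul_mem _ _ hx

lemma wordToL_mem_span {Q : LWord m n → Prop} {u : LWord m n} (hu : Q u) :
    wordToL K u ∈ Submodule.span K (wordToL K '' {u | Q u}) :=
  Submodule.subset_span ⟨u, hu, rfl⟩

/-- The image of a path word is a combination of irreducible path words. -/
lemma wordToL_mem_span_irr {w : LWord m n} {h : ℕ} (hw : LWord.Dyck h w) :
    wordToL K w ∈ Submodule.span K (wordToL K '' {u | u.Irr ∧ LWord.Dyck h u}) := by
  induction w generalizing h with
  | nil => exact wordToL_mem_span K (Q := fun u => u.Irr ∧ LWord.Dyck h u) ⟨irr_nil, hw⟩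
  | cons z w ih =>
    rw [wordToL_cons]
    rcases z with ⟨i, j⟩ | ⟨j, i⟩
    · refine lgen_mul_mem_span_image K _ ?_ (ih (h := h + 1) hw)
      rintro u ⟨hu, hud⟩
      rcases extends_or_inl i j u with hext | ⟨hj, i', u, rfl⟩
      · rw [← wordToL_cons]
        exact wordToL_mem_span K (Q := fun u => u.Irr ∧ LWord.Dyck h u)
          ⟨irr_cons.2 ⟨hext, hu⟩, hud⟩
      · rw [wordToL_cons, ← mul_assoc, lgen_inl_mul_inr, sub_mul, Finset.sum_mul]
        refine Submodule.sub_mem _ ?_ (Submodule.sum_mem _ fun a ha => ?_)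
        · split_ifs
          · rw [one_mul]
            exact wordToL_mem_span K (Q := fun u => u.Irr ∧ LWord.Dyck h u)
              ⟨(irr_cons.1 hu).2, hud⟩
          · simp
        · rw [mul_assoc, ← wordToL_cons, ← wordToL_cons]
          exact wordToL_mem_span K (Q := fun u => u.Irr ∧ LWord.Dyck h u)
            ⟨irr_inl_inr (ne_last_of_mem_erase hj ha) hu, hud⟩
    · cases h with
      | zero => exact hw.elim
      | succ h =>
        refine lgen_mul_mem_span_image K _ ?_ (ih (h := h) hw)
        rintro u ⟨hu, hud⟩
        rcases extends_or_inr j i u with hext | ⟨hi, j', u, rfl⟩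
        · rw [← wordToL_cons]
          exact wordToL_mem_span K (Q := fun u => u.Irr ∧ LWord.Dyck (h + 1) u)
            ⟨irr_cons.2 ⟨hext, hu⟩, hud⟩
        · rw [wordToL_cons, ← mul_assoc, lgen_inr_mul_inl, sub_mul, Finset.sum_mul]
          refine Submodule.sub_mem _ ?_ (Submodule.sum_mem _ fun a ha => ?_)
          · split_ifs
            · rw [one_mul]
              exact wordToL_mem_span K (Q := fun u => u.Irr ∧ LWord.Dyck (h + 1) u)
                ⟨(irr_cons.1 hu).2, hud⟩
            · simp
          · rw [mul_assoc, ← wordToL_cons, ← wordToL_cons]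
            exact wordToL_mem_span K (Q := fun u => u.Irr ∧ LWord.Dyck (h + 1) u)
              ⟨irr_inr_inl (ne_last_of_mem_erase hi ha) hu, hud⟩

/-- The words occurring besides `w` in the normal form of the completion of `w`: irreducible
paths which are longer than `w`, with the same first letter and equally long completion. -/
def LWord.Above (hm : 0 < m) (hn : 0 < n) (h : ℕ) (w u : LWord m n) : Prop :=
  u.Irr ∧ LWord.Dyck h u ∧ w.length < u.length ∧
    (u.completion hm hn h).length = (w.completion hm hn h).length ∧ u.head? = w.head?

/-- The word `y_{1m}^s y_{1a} x_{a1} x_{m1}^s`. -/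
def bump (hm : 0 < m) (hn : 0 < n) (s : ℕ) (a : Fin m) : LWord m n :=
  List.replicate s (y1mLetter hm hn) ++
    Sum.inr (⟨0, hn⟩, a) :: Sum.inl (a, ⟨0, hn⟩) :: List.replicate s (xm1Letter hm hn)

lemma valley_sub_one_mem (hm : 0 < m) (hn : 0 < n) (S : Submodule K (Leavitt K m n))
    (A u : LWord m n) (q : ℕ)
    (hS : ∀ s < q, ∀ a : Fin m, ¬ (a : ℕ) = m - 1 → wordToL K (A ++ (bump hm hn s a ++ u)) ∈ S) :
    wordToL K (A ++ ((List.replicate q (y1mLetter hm hn) ++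
      List.replicate q (xm1Letter hm hn)) ++ u)) - wordToL K (A ++ u) ∈ S := by
  induction q with
  | zero => simp
  | succ q ih =>
    have ih := ih fun s hs => hS s (by omega)
    rw [← sub_add_sub_cancel]
    refine Submodule.add_mem _ ?_ ih
    rw [← neg_mem_iff, neg_sub]
    have : wordToL K (A ++ ((List.replicate q (y1mLetter hm hn) ++
        List.replicate q (xm1Letter hm hn)) ++ u)) -
        wordToL K (A ++ ((List.replicate (q + 1) (y1mLetter hm hn) ++
          List.replicate (q + 1) (xm1Letter hm hn)) ++ u)) =
        ∑ a ∈ Finset.univ.erase (⟨m - 1, by omega⟩ : Fin m),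
          wordToL K (A ++ (bump hm hn q a ++ u)) := by
      rw [List.replicate_succ' (a := y1mLetter hm hn), List.replicate_succ (a := xm1Letter hm hn)]
      simp only [wordToL_append, wordToL_cons, bump]
      have hyx := lgen_inr_mul_inl K (⟨0, hn⟩ : Fin n) ⟨0, hn⟩ (⟨m - 1, by omega⟩ : Fin m)
      rw [if_pos rfl] at hyx
      have hnil : wordToL K ([] : LWord m n) = 1 := by simp [wordToL]
      rw [hnil, mul_one, ← Finset.mul_sum, ← Finset.sum_mul, ← Finset.mul_sum]
      simp only [← mul_assoc (lgen K _) (lgen K _), ← Finset.sum_mul]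
      rw [mul_assoc (wordToL K _) (lgen K _), ← mul_assoc (lgen K _) (lgen K _)]
      simp only [y1mLetter, xm1Letter]
      rw [hyx]
      simp only [sub_mul, mul_sub, one_mul, mul_assoc]
      abel
    rw [this]
    exact Submodule.sum_mem _ fun a ha =>
      hS q (by omega) a (ne_last_of_mem_erase (b := ⟨m - 1, by omega⟩) rfl ha)

lemma irr_append_right {A : LWord m n} {w : LWord m n} (hA : ∀ z ∈ A, z.isRight = true)
    (hw : w.Irr) (hhead : ∃ q, w.head? = some (Sum.inr q)) :
    LWord.Irr (A ++ w) ∧ ∃ q, (A ++ w).head? = some (Sum.inr q) := by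
  induction A with
  | nil => exact ⟨hw, hhead⟩
  | cons z A ih =>
    obtain ⟨h1, q, hq⟩ := ih fun z hz => hA z (by simp [hz])
    rcases z with p | q'
    · simpa using hA (Sum.inl p) (by simp)
    · refine ⟨irr_cons.2 ⟨fun z' hz' => ?_, h1⟩, q', rfl⟩
      obtain rfl := Option.some.inj (hq.symm.trans hz')
      exact not_forbidden_inr_inr _ _

lemma irr_append_left {A : LWord m n} {w : LWord m n} (hA : ∀ z ∈ A, z.isLeft = true)
    (hw : w.Irr) (hhead : ∃ p, w.head? = some (Sum.inl p)) :
    LWord.Irr (A ++ w) ∧ ∃ p, (A ++ w).head? = some (Sum.inl p) := by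
  induction A with
  | nil => exact ⟨hw, hhead⟩
  | cons z A ih =>
    obtain ⟨h1, p, hp⟩ := ih fun z hz => hA z (by simp [hz])
    rcases z with p' | q
    · refine ⟨irr_cons.2 ⟨fun z' hz' => ?_, h1⟩, p', rfl⟩
      obtain rfl := Option.some.inj (hp.symm.trans hz')
      exact not_forbidden_inl_inl _ _
    · simpa using hA (Sum.inr q) (by simp)

lemma dyck_append_left {X w : LWord m n} {h : ℕ} (hX : ∀ z ∈ X, z.isLeft = true)
    (hw : LWord.Dyck (h + X.length) w) : LWord.Dyck h (X ++ w) := by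
  induction X generalizing h with
  | nil => exact hw
  | cons z X ih =>
    rcases z with p | q
    · refine ih (h := h + 1) (fun z hz => hX z (by simp [hz])) ?_
      rwa [List.length_cons, show h + (X.length + 1) = h + 1 + X.length by omega] at hw
    · simpa using hX (Sum.inr q) (by simp)

lemma dyck_append_right {Y w : LWord m n} {h : ℕ} (hY : ∀ z ∈ Y, z.isRight = true)
    (hw : LWord.Dyck h w) : LWord.Dyck (h + Y.length) (Y ++ w) := by
  induction Y with
  | nil => exact hw
  | cons z Y ih =>
    rcases z with p | q
    · simpa using hY (Sum.inl p) (by simp)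
    · exact ih fun z hz => hY z (by simp [hz])

lemma isLeft_of_mem_bump_ascent (hm : 0 < m) (hn : 0 < n) (s : ℕ) (a : Fin m) :
    ∀ z ∈ Sum.inl (a, ⟨0, hn⟩) :: List.replicate s (xm1Letter hm hn), z.isLeft = true := by
  rintro z (_ | ⟨_, hz⟩)
  · rfl
  · rw [List.eq_of_mem_replicate hz]
    rfl

lemma isRight_of_mem_bump_descent (hm : 0 < m) (hn : 0 < n) (s : ℕ) (a : Fin m)
    (y : Fin n × Fin m) :
    ∀ z ∈ Sum.inr y :: (List.replicate s (y1mLetter hm hn) ++ [Sum.inr (⟨0, hn⟩, a)]),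
      z.isRight = true := by
  intro z hz
  simp only [List.mem_cons, List.mem_append, List.not_mem_nil, or_false] at hz
  rcases hz with rfl | hz | rfl
  · rfl
  · rw [List.eq_of_mem_replicate hz]
    rfl
  · rfl

/-- Inserting a bump at a valley of height `q` yields a word above the original one. -/
lemma above_bump (hm : 0 < m) (hn : 0 < n) {q s : ℕ} (hs : s < q) {a : Fin m}
    (ha : ¬ (a : ℕ) = m - 1) (y : Fin n × Fin m) {w u : LWord m n}
    (hu : u.Irr) (hud : LWord.Dyck q u) (hlen : w.length ≤ u.length)
    (hcomp : (u.completion hm hn q).length = (w.completion hm hn q).length)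
    (huw : u.head? = w.head?) (hhead : ∃ p, u.head? = some (Sum.inl p)) :
    LWord.Above hm hn (q + 1) (Sum.inr y :: w) (Sum.inr y :: (bump hm hn s a ++ u)) := by
  let Y : LWord m n := Sum.inr y :: (List.replicate s (y1mLetter hm hn) ++ [Sum.inr (⟨0, hn⟩, a)])
  let X : LWord m n := Sum.inl (a, ⟨0, hn⟩) :: List.replicate s (xm1Letter hm hn)
  have hY : ∀ z ∈ Y, z.isRight = true := isRight_of_mem_bump_descent hm hn s a y
  have hX : ∀ z ∈ X, z.isLeft = true := isLeft_of_mem_bump_ascent hm hn s a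
  have hYl : Y.length = s + 2 := by simp [Y]
  have hXl : X.length = s + 1 := by simp [X]
  have heq : Sum.inr y :: (bump hm hn s a ++ u) = Y ++ (X ++ u) := by simp [bump, X, Y]
  refine ⟨?_, ?_, ?_, ?_, rfl⟩
  · have h1 := irr_append_left hX hu hhead
    have h2 : LWord.Irr (Sum.inr (⟨0, hn⟩, a) :: (X ++ u)) := by
      refine irr_cons.2 ⟨?_, h1.1⟩
      simp only [X, List.cons_append, extends_cons, forbidden_inr_inl]
      exact fun h => ha h.2
    have h3 := irr_append_right (A := Sum.inr y :: List.replicate s (y1mLetter hm hn))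
      (fun z hz => hY z (by simp only [Y, List.mem_cons, List.mem_append] at hz ⊢; tauto))
      h2 ⟨_, rfl⟩
    rw [heq]
    simpa [Y] using h3.1
  · rw [heq]
    have h1 : LWord.Dyck (q - s - 1) (X ++ u) := dyck_append_left hX (by
      rwa [hXl, show q - s - 1 + (s + 1) = q by omega])
    have h2 := dyck_append_right hY h1
    rwa [hYl, show q - s - 1 + (s + 2) = q + 1 by omega] at h2
  · rw [heq]
    simp only [List.length_cons, List.length_append]
    omega
  · obtain ⟨p, hp⟩ := hhead
    obtain ⟨t, rfl⟩ := List.head?_eq_some_iff.1 hp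
    obtain ⟨t', rfl⟩ := List.head?_eq_some_iff.1 (huw.symm.trans hp)
    rw [heq, completion_append_right hm hn hY (by simp [Y]), completion_append_left hm hn hX]
    rw [LWord.completion.eq_3, hYl, hXl, show q + 1 - (s + 2) + (s + 1) = q by omega,
      show q + 1 - 1 = q by omega]
    simp only [List.length_append, List.length_cons, hcomp, hYl, X, List.cons_append,
      LWord.valley, List.length_replicate]
    omega

/-- The completion of an irreducible path is the path itself up to longer irreducible paths. -/
lemma completion_sub_mem (hm : 0 < m) (hn : 0 < n) {w : LWord m n} {h : ℕ} (hirr : w.Irr)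
    (hw : LWord.Dyck h w) :
    wordToL K (w.completion hm hn h) - wordToL K w ∈
      Submodule.span K (wordToL K '' {u | LWord.Above hm hn h w u}) := by
  induction w generalizing h with
  | nil => simp [LWord.completion]
  | cons z w ih =>
    obtain ⟨hext, hirr'⟩ := irr_cons.1 hirr
    rcases z with p | y
    · rw [LWord.completion, wordToL_cons, wordToL_cons, ← mul_sub]
      refine lgen_mul_mem_span_image K _ ?_ (ih (h := h + 1) hirr' hw)
      rintro u ⟨h1, h2, h3, h4, h5⟩
      rw [← wordToL_cons]
      refine wordToL_mem_span K (Q := LWord.Above hm hn h (Sum.inl p :: w))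
        ⟨irr_cons.2 ⟨?_, h1⟩, h2, by simpa using h3, by simpa [LWord.completion] using h4, rfl⟩
      rwa [LWord.Extends, h5]
    · cases h with
      | zero => exact hw.elim
      | succ q =>
        have ih := ih (h := q) hirr' hw
        set S := Submodule.span K
          (wordToL K '' {u | LWord.Above hm hn (q + 1) (Sum.inr y :: w) u}) with hS
        have htail : lgen K (Sum.inr y) * (wordToL K (LWord.completion hm hn q w) - wordToL K w) ∈
            S := by
          refine lgen_mul_mem_span_image K _ ?_ ih
          rintro u ⟨h1, h2, h3, h4, h5⟩
          rw [← wordToL_cons]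
          refine wordToL_mem_span K (Q := LWord.Above hm hn (q + 1) (Sum.inr y :: w))
            ⟨irr_cons.2 ⟨?_, h1⟩, h2, by simpa using h3, ?_, rfl⟩
          · rwa [LWord.Extends, h5]
          · simp [LWord.completion, h4, valley_congr hm hn q h5]
        rcases w with _ | ⟨p | y', w⟩
        · simp [LWord.completion, LWord.valley]
        · have hbump : ∀ u : LWord m n, u.Irr → LWord.Dyck q u →
              (Sum.inl p :: w : LWord m n).length ≤ u.length →
              (u.completion hm hn q).length =
                (LWord.completion hm hn q (Sum.inl p :: w)).length →
              u.head? = some (Sum.inl p) →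
              lgen K (Sum.inr y) * ((wordToL K (LWord.valley hm hn q (Sum.inl p :: w)) - 1) *
                wordToL K u) ∈ S := by
            intro u h1 h2 h3 h4 h5
            have := valley_sub_one_mem K hm hn S [Sum.inr y] u q fun s hs a ha =>
              wordToL_mem_span K (above_bump hm hn hs ha y h1 h2 h3 h4 h5 ⟨p, h5⟩)
            simp only [List.singleton_append, wordToL_cons] at this
            rw [wordToL_append, ← mul_sub, ← sub_one_mul] at this
            exact this
          have hvalley : lgen K (Sum.inr y) *
              ((wordToL K (LWord.valley hm hn q (Sum.inl p :: w)) - 1) *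
                wordToL K (LWord.completion hm hn q (Sum.inl p :: w))) ∈ S := by
            rw [← sub_add_cancel (wordToL K (LWord.completion hm hn q (Sum.inl p :: w)))
              (wordToL K (Sum.inl p :: w)), mul_add, mul_add]
            refine Submodule.add_mem _ ?_ (hbump _ hirr' hw le_rfl rfl rfl)
            rw [← mul_assoc]
            rw [hS]
            revert ih
            generalize wordToL K (LWord.completion hm hn q (Sum.inl p :: w)) -
              wordToL K (Sum.inl p :: w) = b
            intro ih
            induction ih using Submodule.span_induction with
            | mem x hx =>
              obtain ⟨u, ⟨h1, h2, h3, h4, h5⟩, rfl⟩ := hx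
              rw [mul_assoc]
              exact hbump u h1 h2 h3.le h4 h5
            | zero => simp
            | add x y _ _ hx hy =>
              rw [mul_add]
              exact Submodule.add_mem _ hx hy
            | smul c x _ hx =>
              rw [mul_smul_comm]
              exact Submodule.smul_mem _ _ hx
          have := Submodule.add_mem _ hvalley htail
          rw [LWord.completion, wordToL_cons, wordToL_append, wordToL_cons,
            show q + 1 - 1 = q by omega]
          convert this using 1
          simp only [sub_mul, mul_sub, one_mul]
          abel
        · rw [LWord.completion, wordToL_cons, wordToL_cons, ← mul_sub]
          exact htail

lemma wordToL_mem_span_CxySet (hm : 0 < m) (hn : 0 < n) {w : LWord m n} (hirr : w.Irr)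
    (hw : LWord.Dyck 0 w) :
    wordToL K w ∈ Submodule.span K (wordToL K '' CxySet hm hn) := by
  induction hN : (w.completion hm hn 0).length - w.length using Nat.strong_induction_on
    generalizing w with
  | _ N ih =>
    have hmem : wordToL K (w.completion hm hn 0) ∈
        Submodule.span K (wordToL K '' CxySet hm hn) :=
      Submodule.subset_span ⟨_, (mem_CxySet_iff hm hn).2 ⟨w, hirr, hw, rfl⟩, rfl⟩
    rw [← sub_sub_cancel (wordToL K (w.completion hm hn 0)) (wordToL K w)]
    refine Submodule.sub_mem _ hmem ?_
    refine Submodule.span_le.2 ?_ (completion_sub_mem K hm hn hirr hw)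
    rintro _ ⟨u, ⟨h1, h2, h3, h4, -⟩, rfl⟩
    have := length_le_completion hm hn 0 u
    exact ih _ (by omega) h1 h2 rfl

lemma wordToL_mem_L0xy {w : LWord m n} (hw : LWord.Dyck 0 w) : wordToL K w ∈ L0xy K m n := by
  obtain ⟨ws, hws, rfl⟩ := inXY_of_dyck hw
  induction ws with
  | nil => simp [wordToL]
  | cons u ws ih =>
    have hws' : ∀ v ∈ ws, v.IsPrime ∧ v.XY := fun v hv => hws v (by simp [hv])
    rw [List.flatten_cons, wordToL_append]
    refine mul_mem (Algebra.subset_adjoin ⟨u, (hws u (by simp)).1, (hws u (by simp)).2, rfl⟩) ?_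
    exact ih hws' (dyck_of_inXY ⟨ws, hws', rfl⟩)

lemma span_CxySet (hm : 0 < m) (hn : 0 < n) :
    Submodule.span K (wordToL K '' CxySet (m := m) (n := n) hm hn) =
      Subalgebra.toSubmodule (L0xy K m n) := by
  apply le_antisymm
  · rw [Submodule.span_le]
    rintro _ ⟨v, hv, rfl⟩
    obtain ⟨w, hirr, hw, rfl⟩ := (mem_CxySet_iff hm hn).1 hv
    have hle : Submodule.span K (wordToL K '' {u | LWord.Above hm hn 0 w u}) ≤
        Subalgebra.toSubmodule (L0xy K m n) := by
      rw [Submodule.span_le]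
      rintro _ ⟨u, hu, rfl⟩
      exact wordToL_mem_L0xy K hu.2.1
    have := Submodule.add_mem _ (hle (completion_sub_mem K hm hn hirr hw))
      (wordToL_mem_L0xy K hw : wordToL K w ∈ Subalgebra.toSubmodule (L0xy K m n))
    rwa [sub_add_cancel] at this
  · rw [L0xy, Algebra.adjoin_eq_span, Submodule.span_le]
    intro a ha
    have : ∃ w : LWord m n, LWord.Dyck 0 w ∧ wordToL K w = a := by
      induction ha using Submonoid.closure_induction with
      | mem x hx =>
        obtain ⟨w, hp, hxy, rfl⟩ := hx
        exact ⟨w, dyck_of_isPrime hp hxy, rfl⟩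
      | one => exact ⟨[], rfl, by simp [wordToL]⟩
      | mul x y _ _ hx hy =>
        obtain ⟨u, hu, rfl⟩ := hx
        obtain ⟨v, hv, rfl⟩ := hy
        exact ⟨u ++ v, dyck_append (a := 0) (b := 0) hu hv, wordToL_append K u v⟩
    obtain ⟨w, hw, rfl⟩ := this
    refine Submodule.span_le.2 ?_ (wordToL_mem_span_irr K hw)
    rintro _ ⟨u, ⟨h1, h2⟩, rfl⟩
    exact wordToL_mem_span_CxySet K hm hn h1 h2

/-- The coefficient in the completion of `w` of a word that is not longer than `w`. -/
lemma normalForm_completion_apply (hm : 0 < m) (hn : 0 < n) {w w' : LWord m n} (hirr : w.Irr)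
    (hw : LWord.Dyck 0 w) (hle : w'.length ≤ w.length) :
    normalForm K hm hn (wordToL K (w.completion hm hn 0)) w' =
      (Finsupp.single w (1 : K)) w' := by
  rw [← sub_eq_zero, ← Finsupp.sub_apply, ← normalForm_wordToL K hm hn hirr, ← map_sub]
  have h : Submodule.span K (wordToL K '' {u | LWord.Above hm hn 0 w u}) ≤
      LinearMap.ker (Finsupp.lapply w' ∘ₗ normalForm K hm hn) := by
    rw [Submodule.span_le]
    rintro _ ⟨u, hu, rfl⟩
    have hne : u ≠ w' := by
      rintro rfl
      exact absurd hu.2.2.1 (by omega)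
    simp [normalForm_wordToL K hm hn hu.1, hne]
  simpa using h (completion_sub_mem K hm hn hirr hw)

lemma linearIndependent_CxySet (hm : 0 < m) (hn : 0 < n) :
    LinearIndependent K (fun v : CxySet (m := m) (n := n) hm hn => wordToL K v.1) := by
  choose f hirr hdyck hf using fun v : CxySet (m := m) (n := n) hm hn =>
    (mem_CxySet_iff hm hn).1 v.2
  have hinj : Function.Injective f := fun v v' h => Subtype.ext (by rw [hf v, hf v', h])
  rw [linearIndependent_iff]
  intro l hl
  by_contra hne
  obtain ⟨v₀, hv₀, hmin⟩ := Finset.exists_min_image l.support (fun v => (f v).length)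
    (Finsupp.support_nonempty_iff.2 hne)
  have h := congrArg (fun a => normalForm K hm hn a (f v₀)) hl
  simp only [Finsupp.linearCombination_apply, Finsupp.sum, map_sum, map_smul, map_zero,
    Finsupp.finsetSum_apply, Finsupp.smul_apply, Finsupp.zero_apply] at h
  rw [Finset.sum_eq_single_of_mem v₀ hv₀] at h
  · rw [hf v₀, normalForm_completion_apply K hm hn (hirr v₀) (hdyck v₀) le_rfl] at h
    simp at h
    exact Finsupp.mem_support_iff.1 hv₀ h
  · intro v hv hvne
    rw [hf v, normalForm_completion_apply K hm hn (hirr v) (hdyck v) (hmin v hv),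
      Finsupp.single_eq_of_ne (fun h => hvne (hinj h.symm)), smul_zero]

end Spanning

/-- The image in `L(m,n)` of the set `C^{xy}` of completions of words in
`B^{xy}` is a `K`-linear basis of `L(m,n)₀^{xy}`. -/
theorem stmt12 (K : Type) [Field K] (m n : ℕ) (hm : 0 < m) (hn : 0 < n) :
    LinearIndependent K (fun v : CxySet (m := m) (n := n) hm hn => wordToL K v.1) ∧
    Submodule.span K
        (Set.range fun v : CxySet (m := m) (n := n) hm hn => wordToL K v.1) =
      Subalgebra.toSubmodule (L0xy K m n) := by
  refine ⟨linearIndependent_CxySet K hm hn, ?_⟩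
  rw [← span_CxySet K hm hn, Set.image_eq_range]
end

section
/- Let R be a ring, n a positive integer, k ≥ 1, and let u^{(1)}, …, u^{(k)} be n×1 column vectors and v^{(1)}, …, v^{(k)} be 1×n row vectors over R. Then the entry at position (i,j) (1 ≤ i,j ≤ n^k) of the n^k × n^k matrix u^{(k)} ⋆ ⋯ ⋆ u^{(1)} ⋆ v^{(1)} ⋆ ⋯ ⋆ v^{(k)} equals u^{(k)}_{Mod_n(i)} · u^{(k−1)}_{Mod_n(⌈i/n⌉)} ⋯ u^{(1)}_{Mod_n(⌈i/n^{k−1}⌉)} · v^{(1)}_{Mod_n(⌈j/n^{k−1}⌉)} ⋯ v^{(k−1)}_{Mod_n(⌈j/n⌉)} · v^{(k)}_{Mod_n(j)}. -/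
open scoped BigOperators

/-- The block-diagonal matrix `⊕^t A` (with `t` copies of `A ∈ M_{a×b}` on the diagonal and
zeros elsewhere), written as a matrix with `e = t*a` rows and `f = t*b` columns: the entry at
(0-indexed) position `(i,j)` is `A (i % a) (j % b)` if `i / a = j / b`, and `0` otherwise. -/
def blockOplus {R : Type} [Semiring R] {a b : ℕ} (ha : 0 < a) (hb : 0 < b) (e f : ℕ)
    (A : Matrix (Fin a) (Fin b) R) : Matrix (Fin e) (Fin f) R :=
  Matrix.of fun i j =>
    if (i : ℕ) / a = (j : ℕ) / b then A ⟨(i : ℕ) % a, Nat.mod_lt _ ha⟩ ⟨(j : ℕ) % b, Nat.mod_lt _ hb⟩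
    else 0

/-- The column matrix of `u : Fin n → R`. -/
def colMat {R : Type} [Semiring R] {n : ℕ} (u : Fin n → R) : Matrix (Fin n) (Fin 1) R :=
  Matrix.of fun i _ => u i

/-- The row matrix of `v : Fin n → R`. -/
def rowMat {R : Type} [Semiring R] {n : ℕ} (v : Fin n → R) : Matrix (Fin 1) (Fin n) R :=
  Matrix.of fun _ j => v j

/-- The iterated `⋆`-product `u^{(t)} ⋆ ⋯ ⋆ u^{(1)} ⋆ v^{(1)} ⋆ ⋯ ⋆ v^{(t)}` in the monoid
`(𝔐_n(R), ⋆)`, computed via the definition of `⋆` : for `u` an `n × 1` matrix and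
`W ∈ M_{n^t × n^t}`, `u ⋆ W = (⊕^{n^t} u) · W` and `W' ⋆ v = W' · (⊕^{n^t} v)`. -/
def starChain {R : Type} [Semiring R] {n : ℕ} (hn : 0 < n) (u v : ℕ → Fin n → R) :
    (t : ℕ) → Matrix (Fin (n ^ t)) (Fin (n ^ t)) R
  | 0 => 1
  | t + 1 =>
      blockOplus hn one_pos (n ^ (t + 1)) (n ^ t) (colMat (u (t + 1))) *
        starChain hn u v t *
        blockOplus one_pos hn (n ^ t) (n ^ (t + 1)) (rowMat (v (t + 1)))

/-- Left multiplication by `⊕ u` for a column `u`: row `i` of the product is `u_{i % n}` times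
row `i / n`. -/
lemma blockOplus_colMat_mul_apply {R : Type} [Semiring R] {n m p q : ℕ} (hn : 0 < n)
    (u : Fin n → R) (W : Matrix (Fin m) (Fin p) R) (i : Fin q) (j : Fin p)
    (hi : (i : ℕ) / n < m) :
    (blockOplus hn one_pos q m (colMat u) * W) i j =
      u ⟨(i : ℕ) % n, Nat.mod_lt _ hn⟩ * W ⟨(i : ℕ) / n, hi⟩ j := by
  rw [Matrix.mul_apply, Finset.sum_eq_single ⟨(i : ℕ) / n, hi⟩]
  · simp [blockOplus, colMat]
  · intro b _ hb
    have h : ¬ (i : ℕ) / n = b := fun h => hb (Fin.ext h.symm)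
    simp [blockOplus, h]
  · simp

/-- Right multiplication by `⊕ v` for a row `v`: column `j` of the product is column `j / n`
times `v_{j % n}`. -/
lemma mul_blockOplus_rowMat_apply {R : Type} [Semiring R] {n m p q : ℕ} (hn : 0 < n)
    (v : Fin n → R) (W : Matrix (Fin p) (Fin m) R) (i : Fin p) (j : Fin q)
    (hj : (j : ℕ) / n < m) :
    (W * blockOplus one_pos hn m q (rowMat v)) i j =
      W i ⟨(j : ℕ) / n, hj⟩ * v ⟨(j : ℕ) % n, Nat.mod_lt _ hn⟩ := by
  rw [Matrix.mul_apply, Finset.sum_eq_single ⟨(j : ℕ) / n, hj⟩]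
  · simp [blockOplus, rowMat]
  · intro b _ hb
    have h : ¬ (b : ℕ) = j / n := fun h => hb (Fin.ext h)
    simp [blockOplus, h]
  · simp

/-- The recursion for the entries of `starChain`. -/
lemma starChain_succ_apply {R : Type} [Semiring R] {n : ℕ} (hn : 0 < n) (u v : ℕ → Fin n → R)
    (t : ℕ) (i j : Fin (n ^ (t + 1))) :
    starChain hn u v (t + 1) i j =
      u (t + 1) ⟨(i : ℕ) % n, Nat.mod_lt _ hn⟩ *
        starChain hn u v t ⟨(i : ℕ) / n, Nat.div_lt_of_lt_mul (pow_succ' n t ▸ i.isLt)⟩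
          ⟨(j : ℕ) / n, Nat.div_lt_of_lt_mul (pow_succ' n t ▸ j.isLt)⟩ *
        v (t + 1) ⟨(j : ℕ) % n, Nat.mod_lt _ hn⟩ := by
  rw [starChain, mul_blockOplus_rowMat_apply, blockOplus_colMat_mul_apply]

/-- (Lemma `lemeasyind`.) For column vectors `u^{(1)}, …, u^{(k)}` and row
vectors `v^{(1)}, …, v^{(k)}` over a ring `R`, the `(i,j)` entry of the `n^k × n^k` matrix
`u^{(k)} ⋆ ⋯ ⋆ u^{(1)} ⋆ v^{(1)} ⋆ ⋯ ⋆ v^{(k)}` equals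
`u^{(k)}_{Mod_n i} u^{(k−1)}_{Mod_n ⌈i/n⌉} ⋯ u^{(1)}_{Mod_n ⌈i/n^{k−1}⌉} ·
 v^{(1)}_{Mod_n ⌈j/n^{k−1}⌉} ⋯ v^{(k−1)}_{Mod_n ⌈j/n⌉} v^{(k)}_{Mod_n j}`
(written 0-indexed: `Mod_n ⌈(i+1)/n^s⌉ − 1 = (i / n^s) % n`). -/
theorem stmt13 (R : Type) [Ring R] (n : ℕ) (hn : 0 < n) (k : ℕ) (hk : 1 ≤ k)
    (u v : ℕ → Fin n → R) (i j : Fin (n ^ k)) :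
    starChain hn u v k i j =
      ((List.range k).map fun s =>
          u (k - s) ⟨((i : ℕ) / n ^ s) % n, Nat.mod_lt _ hn⟩).prod *
      ((List.range k).map fun s =>
          v (s + 1) ⟨((j : ℕ) / n ^ (k - 1 - s)) % n, Nat.mod_lt _ hn⟩).prod := by
  clear hk
  induction k with
  | zero =>
    obtain rfl : i = j := Subsingleton.elim (α := Fin 1) i j
    rw [starChain, Matrix.one_apply_eq]
    simp
  | succ t ih =>
    rw [starChain_succ_apply, ih, List.range_succ_eq_map, List.map_cons, List.prod_cons,
      ← List.range_succ_eq_map, List.range_succ, List.map_append, List.prod_append]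
    have hv : ∀ s ∈ List.range t,
        v (s + 1) ⟨(j : ℕ) / n / n ^ (t - 1 - s) % n, Nat.mod_lt _ hn⟩ =
          v (s + 1) ⟨(j : ℕ) / n ^ (t + 1 - 1 - s) % n, Nat.mod_lt _ hn⟩ := by
      intro s hs
      have hst : t + 1 - 1 - s = t - 1 - s + 1 := by
        have := List.mem_range.mp hs
        omega
      simp only [Nat.div_div_eq_div_mul, ← pow_succ', hst]
    rw [List.map_congr_left hv]
    simp [Nat.div_div_eq_div_mul, ← pow_succ', Function.comp_def, mul_assoc]
end

section
/- In the monoid (𝔐_m(A(m,n)), ⋆) of matrices over the algebra A(m,n), the following relations hold: (iii) e^{p,1,1} ⋆ e^{p',k',l'} = e^{p',k',l'} whenever p < p'; (iv) e^{p,k,l} ⋆ e^{p',k',l'} = 0 whenever p < p' and l ≠ 1; (v) e^{p,k,l} ⋆ e^{p',1,1} = e^{p,k,l} whenever p > p'; and (vi) e^{p,k,l} ⋆ e^{p',k',l'} = 0 whenever p > p' and k' ≠ 1. -/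
open scoped BigOperators

/-- Generators of the algebra `A(m,n)`: `⟨p, k, l, i, j⟩` stands for the generator
`e^{p+1,k,l}_{ij}` (everything 0-indexed, so the stored `p : ℕ` represents the paper's
`p ≥ 1` shifted by one; `k, l ∈ Fin n`; `i, j ∈ Fin (m^(p+1))`). -/
abbrev AGen (m n : ℕ) := Σ p : ℕ, Fin n × Fin n × Fin (m ^ (p + 1)) × Fin (m ^ (p + 1))

/-- The matrix `e^{p+1,k,l}` of generators, as a matrix over the free algebra. -/
noncomputable def EmF (K : Type) [Field K] (m n : ℕ) (p : ℕ) (k l : Fin n) :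
    Matrix (Fin (m ^ (p + 1))) (Fin (m ^ (p + 1))) (FreeAlgebra K (AGen m n)) :=
  Matrix.of fun i j => FreeAlgebra.ι K (⟨p, k, l, i, j⟩ : AGen m n)

/-- The defining relations of `A(m,n)` (entrywise):
(i) `e^{p,k,l} e^{p,k',l'} = δ_{l,k'} e^{p,k,l'}` and
(ii) `∑_k e^{p,k,k} = ⊕^m e^{p−1,1,1}` (with `e^{0,1,1} = (1)`). -/
inductive ARel (K : Type) [Field K] (m n : ℕ) (hm : 0 < m) (hn : 0 < n) :
    FreeAlgebra K (AGen m n) → FreeAlgebra K (AGen m n) → Prop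
  | mul (p : ℕ) (k l k' l' : Fin n) (i j : Fin (m ^ (p + 1))) :
      ARel K m n hm hn ((EmF K m n p k l * EmF K m n p k' l') i j)
        (if l = k' then EmF K m n p k l' i j else 0)
  | sum0 (i j : Fin (m ^ (0 + 1))) :
      ARel K m n hm hn (∑ kk : Fin n, EmF K m n 0 kk kk i j) (if i = j then 1 else 0)
  | sumS (p : ℕ) (i j : Fin (m ^ (p + 1 + 1))) :
      ARel K m n hm hn (∑ kk : Fin n, EmF K m n (p + 1) kk kk i j)
        (if (i : ℕ) / m ^ (p + 1) = (j : ℕ) / m ^ (p + 1) then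
          EmF K m n p ⟨0, hn⟩ ⟨0, hn⟩
            ⟨(i : ℕ) % m ^ (p + 1), Nat.mod_lt _ (pow_pos hm _)⟩
            ⟨(j : ℕ) % m ^ (p + 1), Nat.mod_lt _ (pow_pos hm _)⟩
        else 0)

/-- The algebra `A(m,n)`. -/
abbrev AAlg (K : Type) [Field K] (m n : ℕ) (hm : 0 < m) (hn : 0 < n) :=
  RingQuot (ARel K m n hm hn)

/-- The image of a generator in `A(m,n)`. -/
noncomputable def mkA (K : Type) [Field K] {m n : ℕ} (hm : 0 < m) (hn : 0 < n)
    (g : AGen m n) : AAlg K m n hm hn :=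
  RingQuot.mkAlgHom K (ARel K m n hm hn) (FreeAlgebra.ι K g)

/-- The matrix `e^{p+1,k,l}` over `A(m,n)`. -/
noncomputable def eA (K : Type) [Field K] {m n : ℕ} (hm : 0 < m) (hn : 0 < n)
    (p : ℕ) (k l : Fin n) :
    Matrix (Fin (m ^ (p + 1))) (Fin (m ^ (p + 1))) (AAlg K m n hm hn) :=
  (EmF K m n p k l).map (RingQuot.mkAlgHom K (ARel K m n hm hn))

theorem blockOplus_mul_blockOplus {R : Type} [Semiring R] {a e : ℕ} (ha : 0 < a) (hae : a ∣ e)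
    (A B : Matrix (Fin a) (Fin a) R) :
    blockOplus ha ha e e A * blockOplus ha ha e e B = blockOplus ha ha e e (A * B) := by
  obtain ⟨t, rfl⟩ := hae
  rw [mul_comm a t]
  ext i j
  have hi : (i : ℕ) / a < t := (Nat.div_lt_iff_lt_mul ha).2 i.2
  rw [Matrix.mul_apply, ← finProdFinEquiv.sum_comp, Fintype.sum_prod_type,
    Finset.sum_eq_single ⟨(i : ℕ) / a, hi⟩]
  · by_cases h : (i : ℕ) / a = j / a <;>
      simp [blockOplus, Matrix.mul_apply, Nat.add_mul_div_left _ _ ha, Nat.div_eq_of_lt,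
        Nat.mod_eq_of_lt, h]
  · intro b _ hb
    have hne : (i : ℕ) / a ≠ b := fun h => hb (Fin.ext h.symm)
    simp [blockOplus, Nat.add_mul_div_left _ _ ha, Nat.div_eq_of_lt, hne]
  · simp

theorem blockOplus_blockOplus {R : Type} [Semiring R] {a b : ℕ} (ha : 0 < a) (hb : 0 < b)
    (hab : a ∣ b) (e : ℕ) (A : Matrix (Fin a) (Fin a) R) :
    blockOplus hb hb e e (blockOplus ha ha b b A) = blockOplus ha ha e e A := by
  obtain ⟨c, rfl⟩ := hab
  ext i j
  have key : ((i : ℕ) / (a * c) = j / (a * c) ∧ (i : ℕ) % (a * c) / a = j % (a * c) / a) ↔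
      (i : ℕ) / a = j / a := by
    rw [Nat.mod_mul_right_div_self, Nat.mod_mul_right_div_self, ← Nat.div_div_eq_div_mul,
      ← Nat.div_div_eq_div_mul]
    refine ⟨fun ⟨h₁, h₂⟩ => ?_, fun h => by simp [h]⟩
    rw [← Nat.div_add_mod ((i : ℕ) / a) c, h₁, h₂, Nat.div_add_mod]
  simp only [blockOplus, Matrix.of_apply, ← ite_and, key, Nat.mod_mul_right_mod]

theorem blockOplus_zero {R : Type} [Semiring R] {a b : ℕ} (ha : 0 < a) (hb : 0 < b) (e f : ℕ) :
    blockOplus ha hb e f (0 : Matrix (Fin a) (Fin b) R) = 0 := by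
  ext i j
  simp [blockOplus]

section Relations

variable (K : Type) [Field K] {m n : ℕ} (hm : 0 < m) (hn : 0 < n)

theorem eA_mul_eA (p : ℕ) (k l k' l' : Fin n) :
    eA K hm hn p k l * eA K hm hn p k' l' = if l = k' then eA K hm hn p k l' else 0 := by
  ext i j
  have h := RingQuot.mkAlgHom_rel K (ARel.mul (K := K) (hm := hm) (hn := hn) p k l k' l' i j)
  rw [eA, eA, ← Matrix.map_mul, Matrix.map_apply, h]
  split_ifs <;> simp [eA]

theorem sum_eA_succ (p : ℕ) :
    ∑ k : Fin n, eA K hm hn (p + 1) k k =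
      blockOplus (pow_pos hm (p + 1)) (pow_pos hm (p + 1)) (m ^ (p + 1 + 1)) (m ^ (p + 1 + 1))
        (eA K hm hn p ⟨0, hn⟩ ⟨0, hn⟩) := by
  ext i j
  have h := RingQuot.mkAlgHom_rel K (ARel.sumS (K := K) (hm := hm) (hn := hn) p i j)
  rw [map_sum] at h
  rw [Matrix.sum_apply]
  refine h.trans ?_
  simp only [blockOplus, Matrix.of_apply]
  split_ifs <;> simp [eA]

theorem blockOplus_eA_mul_eA_succ (p : ℕ) (k l : Fin n) :
    blockOplus (pow_pos hm (p + 1)) (pow_pos hm (p + 1)) (m ^ (p + 1 + 1)) (m ^ (p + 1 + 1))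
      (eA K hm hn p ⟨0, hn⟩ ⟨0, hn⟩) * eA K hm hn (p + 1) k l = eA K hm hn (p + 1) k l := by
  simp [← sum_eA_succ, Finset.sum_mul, eA_mul_eA]

theorem eA_succ_mul_blockOplus_eA (p : ℕ) (k l : Fin n) :
    eA K hm hn (p + 1) k l *
      blockOplus (pow_pos hm (p + 1)) (pow_pos hm (p + 1)) (m ^ (p + 1 + 1)) (m ^ (p + 1 + 1))
        (eA K hm hn p ⟨0, hn⟩ ⟨0, hn⟩) = eA K hm hn (p + 1) k l := by
  simp [← sum_eA_succ, Finset.mul_sum, eA_mul_eA]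

theorem blockOplus_eA_mul_eA {p p' : ℕ} (hpp : p < p') (k l : Fin n) :
    blockOplus (pow_pos hm (p + 1)) (pow_pos hm (p + 1)) (m ^ (p' + 1)) (m ^ (p' + 1))
      (eA K hm hn p ⟨0, hn⟩ ⟨0, hn⟩) * eA K hm hn p' k l = eA K hm hn p' k l := by
  induction p', hpp using Nat.le_induction generalizing k l with
  | base => exact blockOplus_eA_mul_eA_succ K hm hn p k l
  | succ q hq ih =>
    rw [← blockOplus_eA_mul_eA_succ K hm hn q k l, ← Matrix.mul_assoc,
      ← blockOplus_blockOplus (pow_pos hm (p + 1)) (pow_pos hm (q + 1))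
        (pow_dvd_pow m (by lia)), blockOplus_mul_blockOplus _ (pow_dvd_pow m (by lia)), ih]

theorem eA_mul_blockOplus_eA {p p' : ℕ} (hpp : p < p') (k l : Fin n) :
    eA K hm hn p' k l *
      blockOplus (pow_pos hm (p + 1)) (pow_pos hm (p + 1)) (m ^ (p' + 1)) (m ^ (p' + 1))
        (eA K hm hn p ⟨0, hn⟩ ⟨0, hn⟩) = eA K hm hn p' k l := by
  induction p', hpp using Nat.le_induction generalizing k l with
  | base => exact eA_succ_mul_blockOplus_eA K hm hn p k l
  | succ q hq ih =>
    rw [← eA_succ_mul_blockOplus_eA K hm hn q k l, Matrix.mul_assoc,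
      ← blockOplus_blockOplus (pow_pos hm (p + 1)) (pow_pos hm (q + 1))
        (pow_dvd_pow m (by lia)), blockOplus_mul_blockOplus _ (pow_dvd_pow m (by lia)), ih]

end Relations

/-- (Lemma `lemAmnrel`.) In the monoid `(𝔐_m(A(m,n)), ⋆)` (written
0-indexed, so `p` below is the paper's `p − 1` and the index `1` is `⟨0, hn⟩`):
(iii) `e^{p,1,1} ⋆ e^{p',k',l'} = e^{p',k',l'}` for `p < p'`;
(iv) `e^{p,k,l} ⋆ e^{p',k',l'} = 0` for `p < p'` and `l ≠ 1`;
(v) `e^{p,k,l} ⋆ e^{p',1,1} = e^{p,k,l}` for `p > p'`;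
(vi) `e^{p,k,l} ⋆ e^{p',k',l'} = 0` for `p > p'` and `k' ≠ 1`.
Here, for `p < p'`, `A ⋆ B = (⊕^{m^{p'−p}} A) · B` and `B ⋆ A = B · (⊕^{m^{p'−p}} A)` by
the definition of `⋆`. -/
theorem stmt14 (K : Type) [Field K] (m n : ℕ) (hm : 0 < m) (hn : 0 < n)
    (p p' : ℕ) (hpp : p < p') (k l k' l' : Fin n) :
    (blockOplus (pow_pos hm (p + 1)) (pow_pos hm (p + 1)) (m ^ (p' + 1)) (m ^ (p' + 1))
        (eA K hm hn p ⟨0, hn⟩ ⟨0, hn⟩) * eA K hm hn p' k' l' = eA K hm hn p' k' l') ∧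
    (l ≠ ⟨0, hn⟩ →
      blockOplus (pow_pos hm (p + 1)) (pow_pos hm (p + 1)) (m ^ (p' + 1)) (m ^ (p' + 1))
        (eA K hm hn p k l) * eA K hm hn p' k' l' = 0) ∧
    (eA K hm hn p' k l *
        blockOplus (pow_pos hm (p + 1)) (pow_pos hm (p + 1)) (m ^ (p' + 1)) (m ^ (p' + 1))
          (eA K hm hn p ⟨0, hn⟩ ⟨0, hn⟩) = eA K hm hn p' k l) ∧
    (k' ≠ ⟨0, hn⟩ →
      eA K hm hn p' k l *
        blockOplus (pow_pos hm (p + 1)) (pow_pos hm (p + 1)) (m ^ (p' + 1)) (m ^ (p' + 1))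
          (eA K hm hn p k' l') = 0) := by
  have hdvd : m ^ (p + 1) ∣ m ^ (p' + 1) := pow_dvd_pow m (by lia)
  refine ⟨blockOplus_eA_mul_eA K hm hn hpp k' l', fun hl => ?_,
    eA_mul_blockOplus_eA K hm hn hpp k l, fun hk => ?_⟩
  · rw [← blockOplus_eA_mul_eA K hm hn hpp k' l', ← Matrix.mul_assoc,
      blockOplus_mul_blockOplus _ hdvd, eA_mul_eA, if_neg hl, blockOplus_zero, Matrix.zero_mul]
  · rw [← eA_mul_blockOplus_eA K hm hn hpp k l, Matrix.mul_assoc,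
      blockOplus_mul_blockOplus _ hdvd, eA_mul_eA, if_neg hk.symm, blockOplus_zero,
      Matrix.mul_zero]
end

section
/- A(m,n) is isomorphic, via the identity on the generators e^{p,k,l}_{ij}, to the K-algebra presented by the generators e^{p,k,l}_{ij} (p ≥ 1, 1 ≤ k,l ≤ n, 1 ≤ i,j ≤ m^p) and the relations: (i) Σ_{r=1}^{m^p} e^{p,k,l}_{ir} e^{p,k',l'}_{rj} = δ_{l,k'} e^{p,k,l'}_{ij}; (ii) Σ_{k=1}^{n} e^{p,k,k}_{ij} = e^{p−1,1,1}_{rs} if i = t m^{p−1} + r and j = t m^{p−1} + s for some 0 ≤ t < m and 1 ≤ r,s ≤ m^{p−1}, and = 0 otherwise (with e^{0,1,1}_{11} = 1); (iii) Σ_{r=1}^{m^{p}} e^{p,1,1}_{ir} e^{p',k',l'}_{t m^{p}+r, j} = e^{p',k',l'}_{t m^{p}+i, j} for p < p', 1 ≤ i ≤ m^{p}, 1 ≤ j ≤ m^{p'}, 0 ≤ t < m^{p'−p}; (iv) Σ_{r=1}^{m^{p}} e^{p,k,l}_{ir} e^{p',k',l'}_{t m^{p}+r, j} = 0 for p < p',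 l ≠ 1, and i, j, t as in (iii); (v) Σ_{r=1}^{m^{p'}} e^{p,k,l}_{i, t m^{p'}+r} e^{p',1,1}_{rj} = e^{p,k,l}_{i, t m^{p'}+j} for p > p', 1 ≤ i ≤ m^{p}, 1 ≤ j ≤ m^{p'}, 0 ≤ t < m^{p−p'}; (vi) Σ_{r=1}^{m^{p'}} e^{p,k,l}_{i, t m^{p'}+r} e^{p',k',l'}_{rj} = 0 for p > p', k' ≠ 1, and i, j, t as in (v). -/
open scoped BigOperators

/-- Index bound used in the entrywise presentation of `A(m,n)`. -/
lemma idxLt {m : ℕ} (hm : 0 < m) {p p' t r : ℕ} (hpp : p < p') (ht : t < m ^ (p' - p))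
    (hr : r < m ^ (p + 1)) : t * m ^ (p + 1) + r < m ^ (p' + 1) := by
  have h2 : (t + 1) * m ^ (p + 1) ≤ m ^ (p' - p) * m ^ (p + 1) :=
    Nat.mul_le_mul_right _ ht
  have h3 : m ^ (p' - p) * m ^ (p + 1) = m ^ (p' + 1) := by
    rw [← pow_add]; congr 1; omega
  nlinarith [hr, h2, h3]

/-- The entrywise relations (i)–(vi) of Lemma `lemAmnpres` (0-indexed; the stored `p : ℕ`
represents the paper's `p` shifted by one, and the index `1` is `⟨0, hn⟩`). -/
inductive APresRel (K : Type) [Field K] (m n : ℕ) (hm : 0 < m) (hn : 0 < n) :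
    FreeAlgebra K (AGen m n) → FreeAlgebra K (AGen m n) → Prop
  | rel1 (p : ℕ) (k l k' l' : Fin n) (i j : Fin (m ^ (p + 1))) :
      APresRel K m n hm hn
        (∑ r : Fin (m ^ (p + 1)),
          FreeAlgebra.ι K (⟨p, k, l, i, r⟩ : AGen m n) *
            FreeAlgebra.ι K (⟨p, k', l', r, j⟩ : AGen m n))
        (if l = k' then FreeAlgebra.ι K (⟨p, k, l', i, j⟩ : AGen m n) else 0)
  | rel2a (i j : Fin (m ^ (0 + 1))) :
      APresRel K m n hm hn
        (∑ kk : Fin n, FreeAlgebra.ι K (⟨0, kk, kk, i, j⟩ : AGen m n))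
        (if i = j then 1 else 0)
  | rel2b (p : ℕ) (i j : Fin (m ^ (p + 1 + 1))) :
      APresRel K m n hm hn
        (∑ kk : Fin n, FreeAlgebra.ι K (⟨p + 1, kk, kk, i, j⟩ : AGen m n))
        (if (i : ℕ) / m ^ (p + 1) = (j : ℕ) / m ^ (p + 1) then
          FreeAlgebra.ι K (⟨p, ⟨0, hn⟩, ⟨0, hn⟩,
            ⟨(i : ℕ) % m ^ (p + 1), Nat.mod_lt _ (pow_pos hm _)⟩,
            ⟨(j : ℕ) % m ^ (p + 1), Nat.mod_lt _ (pow_pos hm _)⟩⟩ : AGen m n)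
        else 0)
  | rel3 (p p' : ℕ) (hpp : p < p') (k' l' : Fin n) (i : Fin (m ^ (p + 1)))
      (j : Fin (m ^ (p' + 1))) (t : ℕ) (ht : t < m ^ (p' - p)) :
      APresRel K m n hm hn
        (∑ r : Fin (m ^ (p + 1)),
          FreeAlgebra.ι K (⟨p, ⟨0, hn⟩, ⟨0, hn⟩, i, r⟩ : AGen m n) *
            FreeAlgebra.ι K (⟨p', k', l',
              ⟨t * m ^ (p + 1) + (r : ℕ), idxLt hm hpp ht r.isLt⟩, j⟩ : AGen m n))
        (FreeAlgebra.ι K (⟨p', k', l',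
          ⟨t * m ^ (p + 1) + (i : ℕ), idxLt hm hpp ht i.isLt⟩, j⟩ : AGen m n))
  | rel4 (p p' : ℕ) (hpp : p < p') (k l k' l' : Fin n) (hl : l ≠ ⟨0, hn⟩)
      (i : Fin (m ^ (p + 1))) (j : Fin (m ^ (p' + 1))) (t : ℕ) (ht : t < m ^ (p' - p)) :
      APresRel K m n hm hn
        (∑ r : Fin (m ^ (p + 1)),
          FreeAlgebra.ι K (⟨p, k, l, i, r⟩ : AGen m n) *
            FreeAlgebra.ι K (⟨p', k', l',
              ⟨t * m ^ (p + 1) + (r : ℕ), idxLt hm hpp ht r.isLt⟩, j⟩ : AGen m n))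
        0
  | rel5 (p p' : ℕ) (hpp : p' < p) (k l : Fin n) (i : Fin (m ^ (p + 1)))
      (j : Fin (m ^ (p' + 1))) (t : ℕ) (ht : t < m ^ (p - p')) :
      APresRel K m n hm hn
        (∑ r : Fin (m ^ (p' + 1)),
          FreeAlgebra.ι K (⟨p, k, l, i,
              ⟨t * m ^ (p' + 1) + (r : ℕ), idxLt hm hpp ht r.isLt⟩⟩ : AGen m n) *
            FreeAlgebra.ι K (⟨p', ⟨0, hn⟩, ⟨0, hn⟩, r, j⟩ : AGen m n))
        (FreeAlgebra.ι K (⟨p, k, l, i,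
          ⟨t * m ^ (p' + 1) + (j : ℕ), idxLt hm hpp ht j.isLt⟩⟩ : AGen m n))
  | rel6 (p p' : ℕ) (hpp : p' < p) (k l k' l' : Fin n) (hk' : k' ≠ ⟨0, hn⟩)
      (i : Fin (m ^ (p + 1))) (j : Fin (m ^ (p' + 1))) (t : ℕ) (ht : t < m ^ (p - p')) :
      APresRel K m n hm hn
        (∑ r : Fin (m ^ (p' + 1)),
          FreeAlgebra.ι K (⟨p, k, l, i,
              ⟨t * m ^ (p' + 1) + (r : ℕ), idxLt hm hpp ht r.isLt⟩⟩ : AGen m n) *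
            FreeAlgebra.ι K (⟨p', k', l', r, j⟩ : AGen m n))
        0

/-- The algebra presented by the generators `e^{p,k,l}_{ij}` and the entrywise
relations (i)–(vi). -/
abbrev APresAlg (K : Type) [Field K] (m n : ℕ) (hm : 0 < m) (hn : 0 < n) :=
  RingQuot (APresRel K m n hm hn)

section MatrixUnits

variable {B : Type*} [Ring B] {m n : ℕ}

/-- The relations (i) and (ii) of `A(m,n)` for a family `e` of elements of a ring, with matrix
indices in `ℕ`; only the entries `e p k l i j` with `i, j < m ^ (p + 1)` matter. -/
structure IsMatrixUnitTower (m : ℕ) (hn : 0 < n) (e : ℕ → Fin n → Fin n → ℕ → ℕ → B) : Prop where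
  mul : ∀ p k l k' l' i j, i < m ^ (p + 1) → j < m ^ (p + 1) →
    ∑ r ∈ Finset.range (m ^ (p + 1)), e p k l i r * e p k' l' r j =
      if l = k' then e p k l' i j else 0
  sum : ∀ p i j, i < m ^ (p + 1 + 1) → j < m ^ (p + 1 + 1) →
    ∑ k, e (p + 1) k k i j =
      if i / m ^ (p + 1) = j / m ^ (p + 1) then
        e p ⟨0, hn⟩ ⟨0, hn⟩ (i % m ^ (p + 1)) (j % m ^ (p + 1))
      else 0

lemma sum_range_block {M N t : ℕ} (hM : 0 < M) (htN : t * M + M ≤ N) (f : ℕ → B) :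
    ∑ r ∈ Finset.range N, (if t = r / M then f r else 0) =
      ∑ r ∈ Finset.range M, f (t * M + r) := by
  rw [← Finset.sum_filter]
  refine (Finset.sum_nbij (fun r => t * M + r) ?_ ?_ ?_ fun _ _ => rfl).symm
  · intro r hr
    have hr : r < M := by simpa using hr
    simp only [Finset.mem_filter, Finset.mem_range]
    exact ⟨by omega, by rw [mul_comm, Nat.mul_add_div hM, Nat.div_eq_of_lt hr, add_zero]⟩
  · intro a _ b _ h
    simpa using h
  · intro r hr
    have hr : r < N ∧ t = r / M := by simpa using hr
    refine ⟨r % M, by simpa using Nat.mod_lt _ hM, ?_⟩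
    simp only [hr.2]
    exact Nat.div_add_mod' r M

namespace IsMatrixUnitTower

variable {hn : 0 < n} {e : ℕ → Fin n → Fin n → ℕ → ℕ → B}

lemma corner_mul_succ (h : IsMatrixUnitTower m hn e) (hm : 0 < m) {p : ℕ} (k l : Fin n)
    {t i j : ℕ} (ht : t < m) (hi : i < m ^ (p + 1)) (hj : j < m ^ (p + 1 + 1)) :
    ∑ r ∈ Finset.range (m ^ (p + 1)),
      e p ⟨0, hn⟩ ⟨0, hn⟩ i r * e (p + 1) k l (t * m ^ (p + 1) + r) j =
        e (p + 1) k l (t * m ^ (p + 1) + i) j := by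
  have hM : 0 < m ^ (p + 1) := pow_pos hm _
  have hN : t * m ^ (p + 1) + m ^ (p + 1) ≤ m ^ (p + 1 + 1) := by
    rw [pow_succ m (p + 1), mul_comm _ m, ← Nat.succ_mul]
    exact Nat.mul_le_mul_right _ ht
  have hdiv : (t * m ^ (p + 1) + i) / m ^ (p + 1) = t := by
    rw [mul_comm, Nat.mul_add_div hM, Nat.div_eq_of_lt hi, add_zero]
  have hmod : ∀ r < m ^ (p + 1), (t * m ^ (p + 1) + r) % m ^ (p + 1) = r := fun r hr => by
    rw [Nat.mul_add_mod_self_right, Nat.mod_eq_of_lt hr]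
  have hti : t * m ^ (p + 1) + i < m ^ (p + 1 + 1) := by omega
  calc _ = ∑ r ∈ Finset.range (m ^ (p + 1 + 1)), (if t = r / m ^ (p + 1) then
          e p ⟨0, hn⟩ ⟨0, hn⟩ i (r % m ^ (p + 1)) * e (p + 1) k l r j else 0) := by
        rw [sum_range_block hM hN]
        refine Finset.sum_congr rfl fun r hr => ?_
        rw [hmod r (Finset.mem_range.1 hr)]
    _ = ∑ r ∈ Finset.range (m ^ (p + 1 + 1)),
          (∑ q, e (p + 1) q q (t * m ^ (p + 1) + i) r) * e (p + 1) k l r j := by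
        refine Finset.sum_congr rfl fun r hr => ?_
        rw [h.sum p _ _ hti (Finset.mem_range.1 hr), hdiv, hmod i hi, ite_mul, zero_mul]
    _ = ∑ q, if q = k then e (p + 1) q l (t * m ^ (p + 1) + i) j else 0 := by
        simp_rw [Finset.sum_mul]
        rw [Finset.sum_comm]
        exact Finset.sum_congr rfl fun q _ => h.mul _ _ _ _ _ _ _ hti hj
    _ = _ := by simp

lemma corner_mul_add (h : IsMatrixUnitTower m hn e) (hm : 0 < m) (d : ℕ) {p p' : ℕ}
    (hp : p' = p + 1 + d) (k l : Fin n) {t i j : ℕ} (ht : t < m ^ (d + 1))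
    (hi : i < m ^ (p + 1)) (hj : j < m ^ (p' + 1)) :
    ∑ r ∈ Finset.range (m ^ (p + 1)),
      e p ⟨0, hn⟩ ⟨0, hn⟩ i r * e p' k l (t * m ^ (p + 1) + r) j =
        e p' k l (t * m ^ (p + 1) + i) j := by
  induction d generalizing p t i with
  | zero =>
    subst hp
    exact h.corner_mul_succ hm k l (by simpa using ht) hi hj
  | succ d ih =>
    have hu : t % m < m := Nat.mod_lt _ hm
    have hs : t / m < m ^ (d + 1) := by
      rw [Nat.div_lt_iff_lt_mul hm, ← pow_succ]
      exact ht
    have hsplit : ∀ r, t * m ^ (p + 1) + r =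
        t / m * m ^ (p + 1 + 1) + (t % m * m ^ (p + 1) + r) := fun r => by
      conv_lhs => rw [← Nat.div_add_mod t m]
      ring
    have hlt : ∀ r < m ^ (p + 1), t % m * m ^ (p + 1) + r < m ^ (p + 1 + 1) := fun r hr => by
      have := Nat.mul_le_mul_right (m ^ (p + 1)) (Nat.succ_le_of_lt hu)
      rw [Nat.succ_mul] at this
      rw [pow_succ m (p + 1), mul_comm _ m]
      omega
    have ih' : ∀ r < m ^ (p + 1), e p' k l (t * m ^ (p + 1) + r) j =
        ∑ x ∈ Finset.range (m ^ (p + 1 + 1)),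
          e (p + 1) ⟨0, hn⟩ ⟨0, hn⟩ (t % m * m ^ (p + 1) + r) x *
            e p' k l (t / m * m ^ (p + 1 + 1) + x) j := fun r hr => by
      rw [hsplit, ih (by omega) hs (hlt r hr)]
    rw [ih' i hi]
    calc _ = ∑ r ∈ Finset.range (m ^ (p + 1)), ∑ x ∈ Finset.range (m ^ (p + 1 + 1)),
            e p ⟨0, hn⟩ ⟨0, hn⟩ i r *
              e (p + 1) ⟨0, hn⟩ ⟨0, hn⟩ (t % m * m ^ (p + 1) + r) x *
                e p' k l (t / m * m ^ (p + 1 + 1) + x) j := by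
          refine Finset.sum_congr rfl fun r hr => ?_
          rw [ih' r (Finset.mem_range.1 hr), Finset.mul_sum]
          simp_rw [mul_assoc]
      _ = _ := by
          rw [Finset.sum_comm]
          refine Finset.sum_congr rfl fun x hx => ?_
          rw [← Finset.sum_mul, h.corner_mul_succ hm _ _ hu hi (Finset.mem_range.1 hx)]

/-- Relation (iii). -/
lemma corner_mul (h : IsMatrixUnitTower m hn e) (hm : 0 < m) {p p' : ℕ} (hpp : p < p')
    (k l : Fin n) {t i j : ℕ} (ht : t < m ^ (p' - p)) (hi : i < m ^ (p + 1))
    (hj : j < m ^ (p' + 1)) :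
    ∑ r ∈ Finset.range (m ^ (p + 1)),
      e p ⟨0, hn⟩ ⟨0, hn⟩ i r * e p' k l (t * m ^ (p + 1) + r) j =
        e p' k l (t * m ^ (p + 1) + i) j :=
  h.corner_mul_add hm (p' - p - 1) (by omega) k l
    (by rwa [show p' - p - 1 + 1 = p' - p by omega]) hi hj

/-- Relation (iv). -/
lemma mul_eq_zero_of_ne (h : IsMatrixUnitTower m hn e) (hm : 0 < m) {p p' : ℕ} (hpp : p < p')
    (k l k' l' : Fin n) (hl : l ≠ ⟨0, hn⟩) {t i j : ℕ} (ht : t < m ^ (p' - p))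
    (hi : i < m ^ (p + 1)) (hj : j < m ^ (p' + 1)) :
    ∑ r ∈ Finset.range (m ^ (p + 1)), e p k l i r * e p' k' l' (t * m ^ (p + 1) + r) j = 0 := by
  calc _ = ∑ r ∈ Finset.range (m ^ (p + 1)), ∑ x ∈ Finset.range (m ^ (p + 1)),
          e p k l i r * e p ⟨0, hn⟩ ⟨0, hn⟩ r x * e p' k' l' (t * m ^ (p + 1) + x) j := by
        refine Finset.sum_congr rfl fun r hr => ?_
        rw [← h.corner_mul hm hpp k' l' ht (Finset.mem_range.1 hr) hj, Finset.mul_sum]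
        simp_rw [mul_assoc]
    _ = 0 := by
        rw [Finset.sum_comm]
        refine Finset.sum_eq_zero fun x hx => ?_
        rw [← Finset.sum_mul, h.mul _ _ _ _ _ _ _ hi (Finset.mem_range.1 hx), if_neg hl, zero_mul]

/-- Transposing all matrices gives a tower over the opposite ring. -/
lemma transpose (h : IsMatrixUnitTower m hn e) :
    IsMatrixUnitTower m hn fun p k l i j => MulOpposite.op (e p l k j i) where
  mul p k l k' l' i j hi hj := by
    simp_rw [← MulOpposite.op_mul, ← Finset.op_sum]
    rw [h.mul _ _ _ _ _ _ _ hj hi]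
    by_cases hkl : l = k'
    · simp [hkl]
    · simp [hkl, Ne.symm hkl]
  sum p i j hi hj := by
    rw [← Finset.op_sum, h.sum _ _ _ hj hi]
    by_cases hij : i / m ^ (p + 1) = j / m ^ (p + 1)
    · simp [hij]
    · simp [hij, Ne.symm hij]

/-- Relation (v). -/
lemma mul_corner (h : IsMatrixUnitTower m hn e) (hm : 0 < m) {p p' : ℕ} (hpp : p' < p)
    (k l : Fin n) {t i j : ℕ} (ht : t < m ^ (p - p')) (hi : i < m ^ (p + 1))
    (hj : j < m ^ (p' + 1)) :
    ∑ r ∈ Finset.range (m ^ (p' + 1)),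
      e p k l i (t * m ^ (p' + 1) + r) * e p' ⟨0, hn⟩ ⟨0, hn⟩ r j =
        e p k l i (t * m ^ (p' + 1) + j) := by
  have := h.transpose.corner_mul hm hpp l k ht hj hi
  simp_rw [← MulOpposite.op_mul, ← Finset.op_sum] at this
  exact MulOpposite.op_injective this

/-- Relation (vi). -/
lemma mul_eq_zero_of_ne' (h : IsMatrixUnitTower m hn e) (hm : 0 < m) {p p' : ℕ} (hpp : p' < p)
    (k l k' l' : Fin n) (hk : k' ≠ ⟨0, hn⟩) {t i j : ℕ} (ht : t < m ^ (p - p'))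
    (hi : i < m ^ (p + 1)) (hj : j < m ^ (p' + 1)) :
    ∑ r ∈ Finset.range (m ^ (p' + 1)),
      e p k l i (t * m ^ (p' + 1) + r) * e p' k' l' r j = 0 := by
  have := h.transpose.mul_eq_zero_of_ne hm hpp l' k' l k hk ht hj hi
  simp_rw [← MulOpposite.op_mul, ← Finset.op_sum] at this
  exact MulOpposite.op_injective this

end IsMatrixUnitTower

end MatrixUnits

section Presentations

variable (K : Type) [Field K] {m n : ℕ} (hm : 0 < m) (hn : 0 < n)

/-- The entries of `e^{p+1,k,l}` in `A(m,n)`, extended by zero to all natural indices. -/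
noncomputable def entryA (p : ℕ) (k l : Fin n) (i j : ℕ) : AAlg K m n hm hn :=
  if h : i < m ^ (p + 1) ∧ j < m ^ (p + 1) then mkA K hm hn ⟨p, k, l, ⟨i, h.1⟩, ⟨j, h.2⟩⟩ else 0

lemma entryA_of_lt {p : ℕ} (k l : Fin n) {i j : ℕ} (hi : i < m ^ (p + 1))
    (hj : j < m ^ (p + 1)) :
    entryA K hm hn p k l i j = mkA K hm hn ⟨p, k, l, ⟨i, hi⟩, ⟨j, hj⟩⟩ :=
  dif_pos ⟨hi, hj⟩

lemma mkAlgHom_ι_eq_entryA {p : ℕ} (k l : Fin n) (i j : Fin (m ^ (p + 1))) :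
    RingQuot.mkAlgHom K (ARel K m n hm hn) (FreeAlgebra.ι K ⟨p, k, l, i, j⟩) =
      entryA K hm hn p k l i j :=
  (entryA_of_lt K hm hn k l i.isLt j.isLt).symm

lemma isMatrixUnitTower_entryA : IsMatrixUnitTower m hn (entryA K hm hn) where
  mul p k l k' l' i j hi hj := by
    have := RingQuot.mkAlgHom_rel K (ARel.mul (K := K) (hm := hm) (hn := hn) p k l k' l'
      ⟨i, hi⟩ ⟨j, hj⟩)
    rw [apply_ite (RingQuot.mkAlgHom K (ARel K m n hm hn))] at this
    simpa only [Matrix.mul_apply, EmF, Matrix.of_apply, map_sum, map_mul, map_zero,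
      mkAlgHom_ι_eq_entryA, Finset.sum_range] using this
  sum p i j hi hj := by
    have := RingQuot.mkAlgHom_rel K (ARel.sumS (K := K) (hm := hm) (hn := hn) p
      ⟨i, hi⟩ ⟨j, hj⟩)
    rw [apply_ite (RingQuot.mkAlgHom K (ARel K m n hm hn))] at this
    simpa only [EmF, Matrix.of_apply, map_sum, map_zero, mkAlgHom_ι_eq_entryA] using this

lemma mkAlgHom_eq_of_aPresRel {x y : FreeAlgebra K (AGen m n)} (h : APresRel K m n hm hn x y) :
    RingQuot.mkAlgHom K (ARel K m n hm hn) x = RingQuot.mkAlgHom K (ARel K m n hm hn) y := by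
  have T := isMatrixUnitTower_entryA K hm hn
  cases h with
  | rel1 p k l k' l' i j =>
    simpa only [Matrix.mul_apply, EmF, Matrix.of_apply] using
      RingQuot.mkAlgHom_rel K (ARel.mul (K := K) (hm := hm) (hn := hn) p k l k' l' i j)
  | rel2a i j => exact RingQuot.mkAlgHom_rel K (ARel.sum0 i j)
  | rel2b p i j => exact RingQuot.mkAlgHom_rel K (ARel.sumS p i j)
  | rel3 p p' hpp k' l' i j t ht =>
    simpa only [map_sum, map_mul, mkAlgHom_ι_eq_entryA, Finset.sum_range] using
      T.corner_mul hm hpp k' l' ht i.isLt j.isLt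
  | rel4 p p' hpp k l k' l' hl i j t ht =>
    simpa only [map_sum, map_mul, map_zero, mkAlgHom_ι_eq_entryA, Finset.sum_range] using
      T.mul_eq_zero_of_ne hm hpp k l k' l' hl ht i.isLt j.isLt
  | rel5 p p' hpp k l i j t ht =>
    simpa only [map_sum, map_mul, mkAlgHom_ι_eq_entryA, Finset.sum_range] using
      T.mul_corner hm hpp k l ht i.isLt j.isLt
  | rel6 p p' hpp k l k' l' hk i j t ht =>
    simpa only [map_sum, map_mul, map_zero, mkAlgHom_ι_eq_entryA, Finset.sum_range] using
      T.mul_eq_zero_of_ne' hm hpp k l k' l' hk ht i.isLt j.isLt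

lemma aPresRel_of_aRel {x y : FreeAlgebra K (AGen m n)} (h : ARel K m n hm hn x y) :
    APresRel K m n hm hn x y := by
  cases h with
  | mul p k l k' l' i j =>
    simpa only [Matrix.mul_apply, EmF, Matrix.of_apply] using APresRel.rel1 p k l k' l' i j
  | sum0 i j => exact APresRel.rel2a i j
  | sumS p i j => exact APresRel.rel2b p i j

end Presentations

/-- (Lemma `lemAmnpres`.) `A(m,n)` is isomorphic, via the identity on the
generators `e^{p,k,l}_{ij}`, to the algebra presented by the generators `e^{p,k,l}_{ij}` and
the entrywise relations (i)–(vi). -/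
theorem stmt15 (K : Type) [Field K] (m n : ℕ) (hm : 0 < m) (hn : 0 < n) :
    ∃ φ : AAlg K m n hm hn ≃ₐ[K] APresAlg K m n hm hn,
      ∀ g : AGen m n,
        φ (mkA K hm hn g) =
          RingQuot.mkAlgHom K (APresRel K m n hm hn) (FreeAlgebra.ι K g) := by
  let toPres : AAlg K m n hm hn →ₐ[K] APresAlg K m n hm hn :=
    RingQuot.liftAlgHom K ⟨RingQuot.mkAlgHom K (APresRel K m n hm hn),
      fun _ _ h => RingQuot.mkAlgHom_rel K (aPresRel_of_aRel K hm hn h)⟩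
  let ofPres : APresAlg K m n hm hn →ₐ[K] AAlg K m n hm hn :=
    RingQuot.liftAlgHom K ⟨RingQuot.mkAlgHom K (ARel K m n hm hn),
      fun _ _ h => mkAlgHom_eq_of_aPresRel K hm hn h⟩
  refine ⟨AlgEquiv.ofAlgHom toPres ofPres ?_ ?_, fun g => ?_⟩
  · apply RingQuot.ringQuot_ext'
    ext g
    simp [toPres, ofPres]
  · apply RingQuot.ringQuot_ext'
    ext g
    simp [toPres, ofPres]
  · simp [toPres, mkA]
end
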